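/- arXiv:2202.13246 — 2 statements merged into one kernel-verified Lean document; each statement's English description precedes it below -/
import Mathlib

section
/- Let d ≥ 1 and let F be a holomorphic d×d-matrix-valued function on ℂ∖(−∞,0] of class S, i.e. (F(z) − F(z)*)/(z − conj(z)) is positive semidefinite whenever Im z ≠ 0 and F(x) is positive semidefinite for every real x > 0. Then F belongs to class S if and only if there exist positive semidefinite d×d matrices A and C and a positive-matrix-valued Borel measure σ on (0,∞) with ∫_{(0,∞)} (1+t)^{-1} dσ(t) finite, such that F(z) = A + C·z + ∫_{(0,∞)} z/(z+t) dσ(t) for all z ∈ ℂ∖(−∞,0]. -/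
open MeasureTheory
open scoped ComplexOrder ComplexConjugate Matrix

section

open Filter Topology

/-- The value `v* M v` of the sesquilinear form of a matrix. -/
noncomputable def Matrix.quadForm {d : ℕ} (M : Matrix (Fin d) (Fin d) ℂ) (v : Fin d → ℂ) : ℂ :=
  ∑ i, ∑ j, conj (v i) * M i j * v j

namespace Matrix

variable {d : ℕ}

theorem quadForm_eq_dotProduct (M : Matrix (Fin d) (Fin d) ℂ) (v : Fin d → ℂ) :
    M.quadForm v = star v ⬝ᵥ (M *ᵥ v) := by
  simp only [quadForm, dotProduct, mulVec, Finset.mul_sum, Pi.star_apply, RCLike.star_def,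
    mul_assoc]

theorem quadForm_single_add_single (M : Matrix (Fin d) (Fin d) ℂ) (i j : Fin d) (c : ℂ) :
    M.quadForm (Pi.single i 1 + Pi.single j c) =
      M i i + c * M i j + conj c * M j i + conj c * c * M j j := by
  rw [quadForm_eq_dotProduct, mulVec_add, star_add, add_dotProduct, dotProduct_add,
    dotProduct_add]
  simp [dotProduct, mulVec, Pi.single_apply, apply_ite]
  ring

theorem polarization (M : Matrix (Fin d) (Fin d) ℂ) (i j : Fin d) :
    M i j = (1 / 4 : ℂ) * ∑ k : Fin 4, conj (Complex.I ^ (k : ℕ)) *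
      M.quadForm (Pi.single i 1 + Pi.single j (Complex.I ^ (k : ℕ))) := by
  simp only [quadForm_single_add_single, Fin.sum_univ_four]
  simp only [Fin.isValue, Fin.coe_ofNat_eq_mod, Nat.zero_mod, pow_zero, map_one, Nat.one_mod,
    pow_one, Nat.mod_succ, Complex.I_sq, map_neg, Complex.conj_I, Complex.I_pow_three, Nat.reduceMod]
  linear_combination (M i j / 2 - M j i / 2) * Complex.I_sq

theorem posSemidef_iff_quadForm {M : Matrix (Fin d) (Fin d) ℂ} :
    M.PosSemidef ↔ ∀ v, 0 ≤ M.quadForm v := by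
  simp only [quadForm_eq_dotProduct]
  refine ⟨fun h => h.dotProduct_mulVec_nonneg, fun h => .of_dotProduct_mulVec_nonneg ?_ h⟩
  simp only [← quadForm_eq_dotProduct] at h
  have hr : ∀ v, conj (M.quadForm v) = M.quadForm v := fun v =>
    Complex.conj_eq_iff_im.2 (Complex.nonneg_iff.1 (h v)).2.symm
  ext i j
  rw [conjTranspose_apply, polarization M i j, polarization M j i]
  simp only [RCLike.star_def, map_mul, map_sum, hr, Complex.conj_conj]
  congr 1
  · simp [Complex.conj_ofNat]
  refine Finset.sum_bij (fun k _ => -k) (by simp) (by simp) (fun k _ => ⟨-k, by simp⟩) ?_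
  intro k _
  have key : ∀ c c' : ℂ, conj c = c' → conj c * c = 1 →
      c * M.quadForm (Pi.single j 1 + Pi.single i c) =
        conj c' * M.quadForm (Pi.single i 1 + Pi.single j c') := by
    intro c c' h1 h2
    subst h1
    simp only [quadForm_single_add_single, Complex.conj_conj]
    linear_combination (c * M i i - c * M j j) * h2
  apply key
  · fin_cases k <;> simp [Complex.I_pow_three, show (-2 : Fin 4) = 2 from rfl,
      show (-3 : Fin 4) = 1 from rfl]
  · fin_cases k <;> simp [Complex.I_pow_three]

theorem PosSemidef.norm_apply_le {M : Matrix (Fin d) (Fin d) ℂ} (hM : M.PosSemidef)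
    (i j : Fin d) : ‖M i j‖ ≤ (M i i).re + (M j j).re := by
  have h := posSemidef_iff_quadForm.1 hM
  have hd : ∀ k, 0 ≤ (M k k).re := fun k => (Complex.nonneg_iff.1 hM.diag_nonneg).1
  by_cases h0 : M i j = 0
  · rw [h0, norm_zero]; exact add_nonneg (hd i) (hd j)
  have hn : (‖M i j‖ : ℂ) ≠ 0 := by simpa using h0
  have := h (Pi.single i 1 + Pi.single j (-(conj (M i j) / ‖M i j‖)))
  rw [quadForm_single_add_single, ← hM.isHermitian.apply j i] at this
  have e2 : conj (M i j) * M i j = ‖M i j‖ ^ 2 := Complex.conj_mul' _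
  have e : M i i + -(conj (M i j) / ‖M i j‖) * M i j +
      conj (-(conj (M i j) / ‖M i j‖)) * star (M i j) +
      conj (-(conj (M i j) / ‖M i j‖)) * -(conj (M i j) / ‖M i j‖) * M j j =
      M i i - 2 * ‖M i j‖ + M j j := by
    simp only [map_neg, map_div₀, Complex.conj_conj, Complex.conj_ofReal, RCLike.star_def]
    field_simp
    linear_combination (M j j - 2 * ‖M i j‖) * e2
  rw [e] at this
  have := (Complex.nonneg_iff.1 this).1
  simp at this
  linarith [norm_nonneg (M i j)]

end Matrix

theorem MeasureTheory.ae_nonneg_of_forall_integral_mul_nonneg {X : Type*} [TopologicalSpace X]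
    [TopologicalSpace.PseudoMetrizableSpace X] [MeasurableSpace X] [BorelSpace X] {μ : Measure X}
    [IsFiniteMeasure μ] {f : X → ℝ} (hf : Integrable f μ)
    (h : ∀ φ : BoundedContinuousFunction X ℝ, 0 ≤ φ → 0 ≤ ∫ x, φ x * f x ∂μ) :
    0 ≤ᵐ[μ] f := by
  let := TopologicalSpace.pseudoMetrizableSpacePseudoMetric X
  set μ₁ : Measure X := μ.withDensity fun x => ENNReal.ofReal (-f x)
  set μ₂ : Measure X := μ.withDensity fun x => ENNReal.ofReal (f x)
  have m₁ : AEMeasurable (fun x => ENNReal.ofReal (-f x)) μ := hf.neg.aemeasurable.ennreal_ofReal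
  have m₂ : AEMeasurable (fun x => ENNReal.ofReal (f x)) μ := hf.aemeasurable.ennreal_ofReal
  have : IsFiniteMeasure μ₁ := isFiniteMeasure_withDensity_ofReal hf.neg.2
  have : IsFiniteMeasure μ₂ := isFiniteMeasure_withDensity_ofReal hf.2
  have hlint : ∀ φ : BoundedContinuousFunction X NNReal,
      ∫⁻ x, φ x ∂μ₁ ≤ ∫⁻ x, φ x ∂μ₂ := by
    intro φ
    have hφm : AEMeasurable (fun x => (φ x : ENNReal)) μ := by
      exact φ.continuous.measurable.coe_nnreal_ennreal.aemeasurable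
    rw [lintegral_withDensity_eq_lintegral_mul₀ m₁ hφm,
      lintegral_withDensity_eq_lintegral_mul₀ m₂ hφm]
    let ψ : BoundedContinuousFunction X ℝ :=
      BoundedContinuousFunction.comp (fun x : NNReal => (x : ℝ)) (C := 1)
      (LipschitzWith.of_dist_le_mul fun x y => by simp [NNReal.dist_eq, Real.dist_eq]) φ
    have hψ : ∀ x, ψ x = (φ x : ℝ) := fun x => rfl
    have h0 := h ψ (fun x => (φ x).2)
    have hi : Integrable (fun x => ψ x * f x) μ :=
      hf.bdd_mul (c := ‖ψ‖) ψ.continuous.aestronglyMeasurable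
        (Eventually.of_forall fun x => ψ.norm_coe_le_norm x)
    rw [integral_eq_lintegral_pos_part_sub_lintegral_neg_part hi, sub_nonneg] at h0
    have e1 : ∀ x, ENNReal.ofReal (ψ x * f x) = ENNReal.ofReal (f x) * φ x := fun x => by
      rw [hψ, ENNReal.ofReal_mul (φ x).coe_nonneg, ENNReal.ofReal_coe_nnreal, mul_comm]
    have e2 : ∀ x, ENNReal.ofReal (-(ψ x * f x)) = ENNReal.ofReal (-f x) * φ x := fun x => by
      rw [hψ, ← mul_neg, ENNReal.ofReal_mul (φ x).coe_nonneg, ENNReal.ofReal_coe_nnreal, mul_comm]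
    rw [ENNReal.toReal_le_toReal] at h0
    · simpa only [e1, e2, Pi.mul_apply] using h0
    · have := hi.neg.lintegral_lt_top
      simpa using this.ne
    · exact hi.lintegral_lt_top.ne
  have hclosed : ∀ F : Set X, IsClosed F → μ₁ F ≤ μ₂ F := by
    intro F hF
    have t₁ := tendsto_lintegral_thickenedIndicator_of_isClosed μ₁ hF
      (δs := fun n => 1 / ((n : ℝ) + 1)) (fun n => by positivity)
      tendsto_one_div_add_atTop_nhds_zero_nat
    have t₂ := tendsto_lintegral_thickenedIndicator_of_isClosed μ₂ hF
      (δs := fun n => 1 / ((n : ℝ) + 1)) (fun n => by positivity)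
      tendsto_one_div_add_atTop_nhds_zero_nat
    exact le_of_tendsto_of_tendsto' t₁ t₂ fun n => hlint _
  have hle : ∀ s, MeasurableSet s → μ₁ s ≤ μ₂ s := by
    intro s hs
    rw [hs.measure_eq_iSup_isClosed_of_ne_top (measure_ne_top μ₁ s)]
    exact iSup₂_le fun K hK => iSup_le fun hKc => (hclosed K hKc).trans (measure_mono hK)
  have hae : (fun x => ENNReal.ofReal (-f x)) ≤ᵐ[μ] fun x => ENNReal.ofReal (f x) := by
    refine ae_le_of_forall_setLIntegral_le_of_sigmaFinite₀ m₁ fun s hs _ => ?_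
    rw [← withDensity_apply _ hs, ← withDensity_apply _ hs]
    exact hle s hs
  filter_upwards [hae] with x hx
  by_contra hlt
  simp only [Pi.zero_apply, not_le] at hlt
  rw [ENNReal.ofReal_of_nonpos hlt.le] at hx
  have := ENNReal.ofReal_eq_zero.1 (le_antisymm hx bot_le)
  linarith

section

variable {d : ℕ} {α : Type*} [MeasurableSpace α] {μ : Measure α}
  {κ : α → ℂ} {W : α → Matrix (Fin d) (Fin d) ℂ}

theorem Matrix.mul_quadForm (c : ℂ) (M : Matrix (Fin d) (Fin d) ℂ) (v : Fin d → ℂ) :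
    c * M.quadForm v = ∑ i, ∑ j, conj (v i) * (c * M i j) * v j := by
  simp only [quadForm, Finset.mul_sum]
  exact Finset.sum_congr rfl fun i _ => Finset.sum_congr rfl fun j _ => by ring

theorem integrable_mul_quadForm (h : ∀ i j, Integrable (fun a => κ a * W a i j) μ)
    (v : Fin d → ℂ) : Integrable (fun a => κ a * (W a).quadForm v) μ := by
  simp only [Matrix.mul_quadForm]
  exact integrable_finsetSum _ fun i _ => integrable_finsetSum _ fun j _ =>
    ((h i j).const_mul _).mul_const _

theorem integral_mul_quadForm (h : ∀ i j, Integrable (fun a => κ a * W a i j) μ)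
    (v : Fin d → ℂ) : ∫ a, κ a * (W a).quadForm v ∂μ =
      Matrix.quadForm (.of fun i j => ∫ a, κ a * W a i j ∂μ) v := by
  simp only [Matrix.mul_quadForm]
  simp only [Matrix.quadForm, Matrix.of_apply]
  rw [integral_finsetSum _ fun i _ => integrable_finsetSum _ fun j _ =>
    ((h i j).const_mul _).mul_const _]
  refine Finset.sum_congr rfl fun i _ => ?_
  rw [integral_finsetSum _ fun j _ => ((h i j).const_mul _).mul_const _]
  refine Finset.sum_congr rfl fun j _ => ?_
  rw [integral_mul_const, integral_const_mul]

theorem integrable_quadForm (h : ∀ i j, Integrable (fun a => W a i j) μ)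
    (v : Fin d → ℂ) : Integrable (fun a => (W a).quadForm v) μ := by
  simpa using integrable_mul_quadForm (κ := fun _ => 1) (by simpa using h) v

theorem posSemidef_integral_mul (h : ∀ i j, Integrable (fun a => κ a * W a i j) μ)
    (hκ : ∀ᵐ a ∂μ, 0 ≤ κ a) (hW : ∀ᵐ a ∂μ, (W a).PosSemidef) :
    (Matrix.of fun i j => ∫ a, κ a * W a i j ∂μ).PosSemidef := by
  rw [Matrix.posSemidef_iff_quadForm]
  intro v
  rw [← integral_mul_quadForm h]
  apply integral_nonneg_of_ae
  filter_upwards [hκ, hW] with a h1 h2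
  exact mul_nonneg h1 (Matrix.posSemidef_iff_quadForm.1 h2 v)

end

theorem integral_map_withDensity_ofReal {α X : Type*} [MeasurableSpace α]
    {lam : Measure α} [TopologicalSpace X] [MeasurableSpace X] [OpensMeasurableSpace X]
    {s : α → X} (hs : Measurable s) {w : α → ℝ}
    (hw0 : ∀ a, 0 ≤ w a) (hw : Integrable w lam) (φ : C(X, ℝ)) :
    ∫ x, φ x ∂((lam.withDensity fun a => ENNReal.ofReal (w a)).map s) =
      ∫ a, φ (s a) * w a ∂lam := by
  rw [integral_map hs.aemeasurable φ.continuous.aestronglyMeasurable,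
    integral_withDensity_eq_integral_toReal_smul₀ hw.aemeasurable.ennreal_ofReal
      (Eventually.of_forall fun _ => ENNReal.ofReal_lt_top)]
  simp only [ENNReal.toReal_ofReal (hw0 _), smul_eq_mul, mul_comm]

section
variable {d : ℕ} {α : Type*} [MeasurableSpace α] {lam : Measure α} {X : Type*}
  [TopologicalSpace X] [CompactSpace X] [TopologicalSpace.MetrizableSpace X]
  [MeasurableSpace X] [BorelSpace X]

/-- A sequence of finite measures `w n • lam`, pushed forward to a compact metrizable space, with
bounded masses, converges weakly along every ultrafilter. -/
theorem exists_tendsto_integral_ultrafilter {s : α → X} (hs : Measurable s) {w : ℕ → α → ℝ}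
    (hw0 : ∀ n a, 0 ≤ w n a) (hw : ∀ n, Integrable (w n) lam) {C : ℝ}
    (hC : ∀ n, ∫ a, w n a ∂lam ≤ C) (U : Ultrafilter ℕ) :
    ∃ μ : Measure X, IsFiniteMeasure μ ∧ ∀ φ : C(X, ℝ),
      Tendsto (fun n => ∫ a, φ (s a) * w n a ∂lam) U (𝓝 (∫ x, φ x ∂μ)) := by
  have hfin : ∀ n, IsFiniteMeasure (lam.withDensity fun a => ENNReal.ofReal (w n a)) :=
    fun n => isFiniteMeasure_withDensity_ofReal (hw n).2
  let m : ℕ → FiniteMeasure X := fun n =>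
    ⟨(lam.withDensity fun a => ENNReal.ofReal (w n a)).map s, inferInstance⟩
  have hm : ∀ n, m n ∈ {μ : FiniteMeasure X | μ.mass ≤ C.toNNReal} := by
    intro n
    have e : (m n).mass = (∫ a, w n a ∂lam).toNNReal := by
      have h1 : ((m n).mass : ENNReal) = ENNReal.ofReal (∫ a, w n a ∂lam) := by
        rw [FiniteMeasure.ennreal_mass, ofReal_integral_eq_lintegral_ofReal (hw n)
          (Eventually.of_forall (hw0 n))]
        change (Measure.map s _) Set.univ = _
        rw [Measure.map_apply hs .univ, Set.preimage_univ, withDensity_apply _ .univ,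
          Measure.restrict_univ]
      exact ENNReal.coe_inj.1 h1
    simp only [Set.mem_ofPred_eq, e]
    exact Real.toNNReal_le_toNNReal (hC n)
  obtain ⟨μ, -, hμ⟩ := (isCompact_setOfPred_finiteMeasure_le_of_compactSpace X
    C.toNNReal).ultrafilter_le_nhds (U.map m)
    (le_principal_iff.2 (Ultrafilter.mem_map.2 (Filter.mem_of_superset Filter.univ_mem
      fun n _ => hm n)))
  refine ⟨μ, inferInstance, fun φ => ?_⟩
  have ht : Tendsto m U (𝓝 μ) := hμ
  have := FiniteMeasure.tendsto_iff_forall_integral_tendsto.1 ht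
    (BoundedContinuousFunction.mkOfCompact φ)
  refine this.congr fun n => ?_
  exact integral_map_withDensity_ofReal hs (hw0 n) (hw n) φ

/-- Weak compactness for a sequence of positive semidefinite matrix densities of bounded mass. -/
theorem exists_matrix_density_limit {s : α → X} (hs : Measurable s)
    {W : ℕ → α → Matrix (Fin d) (Fin d) ℂ} (hW : ∀ n a, (W n a).PosSemidef)
    (hWi : ∀ n i j, Integrable (fun a => W n a i j) lam) {C : ℝ}
    (hC : ∀ n i, ∫ a, (W n a i i).re ∂lam ≤ C) (U : Ultrafilter ℕ) :
    ∃ (μ : Measure X) (g : X → Matrix (Fin d) (Fin d) ℂ),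
      IsFiniteMeasure μ ∧ (∀ i j, Measurable fun x => g x i j) ∧
      (∀ i j, Integrable (fun x => g x i j) μ) ∧ (∀ᵐ x ∂μ, (g x).PosSemidef) ∧
      ∀ (φ : C(X, ℂ)) i j, Tendsto (fun n => ∫ a, φ (s a) * W n a i j ∂lam) U
        (𝓝 (∫ x, φ x * g x i j ∂μ)) := by
  have hQ0 : ∀ n a v, 0 ≤ ((W n a).quadForm v).re := fun n a v =>
    (Complex.nonneg_iff.1 (Matrix.posSemidef_iff_quadForm.1 (hW n a) v)).1
  have hQr : ∀ n a v, (((W n a).quadForm v).re : ℂ) = (W n a).quadForm v := fun n a v =>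
    (Complex.ext rfl (Complex.nonneg_iff.1 (Matrix.posSemidef_iff_quadForm.1 (hW n a) v)).2)
  have hQi : ∀ n v, Integrable (fun a => ((W n a).quadForm v).re) lam := fun n v =>
    (integrable_quadForm (hWi n) v).re
  have hWn : ∀ n i j, ‖∫ a, W n a i j ∂lam‖ ≤ C + C := by
    intro n i j
    refine (norm_integral_le_of_norm_le ((hWi n i i).re.add (hWi n j j).re)
      (Eventually.of_forall fun a => (hW n a).norm_apply_le i j)).trans ?_
    simp only [Pi.add_apply]
    rw [integral_add (hWi n i i).re (hWi n j j).re]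
    exact add_le_add (hC n i) (hC n j)
  have hQC : ∀ n v, ∫ a, ((W n a).quadForm v).re ∂lam ≤
      ∑ i : Fin d, ∑ j : Fin d, ‖v i‖ * (C + C) * ‖v j‖ := by
    intro n v
    have e1 : ∫ a, ((W n a).quadForm v).re ∂lam = (∫ a, (W n a).quadForm v ∂lam).re :=
      integral_re (integrable_quadForm (hWi n) v)
    have e2 := integral_mul_quadForm (κ := fun _ => 1) (by simpa using hWi n) v
    simp only [one_mul] at e2
    rw [e1, e2]
    refine (Complex.re_le_norm _).trans ((norm_sum_le _ _).trans (Finset.sum_le_sum fun i _ =>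
      (norm_sum_le _ _).trans (Finset.sum_le_sum fun j _ => ?_)))
    simp only [Matrix.of_apply, norm_mul, RCLike.norm_conj]
    gcongr
    exact hWn n i j
  choose m hmfin hm using fun v => exists_tendsto_integral_ultrafilter hs
    (fun n a => hQ0 n a v) (fun n => hQi n v) (fun n => hQC n v) U
  set p : Fin d → Fin d → Fin 4 → Fin d → ℂ := fun i j k =>
    Pi.single i 1 + Pi.single j (Complex.I ^ (k : ℕ)) with hp
  set μ : Measure X := ∑ i, ∑ j, ∑ k, m (p i j k) with hμ
  have hμfin : IsFiniteMeasure μ := by infer_instance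
  have hle : ∀ i j k, m (p i j k) ≪ μ := by
    intro i j k
    refine Measure.absolutelyContinuous_of_le ?_
    calc m (p i j k) ≤ ∑ k, m (p i j k) :=
          Finset.single_le_sum (f := fun k => m (p i j k)) (fun _ _ => Measure.zero_le _)
            (Finset.mem_univ k)
      _ ≤ ∑ j, ∑ k, m (p i j k) :=
          Finset.single_le_sum (f := fun j => ∑ k, m (p i j k)) (fun _ _ => Measure.zero_le _)
            (Finset.mem_univ j)
      _ ≤ μ := Finset.single_le_sum (f := fun i => ∑ j, ∑ k, m (p i j k))
            (fun _ _ => Measure.zero_le _) (Finset.mem_univ i)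
  let r : (Fin d → ℂ) → X → ℝ := fun v x => ((m v).rnDeriv μ x).toReal
  have hrm : ∀ v, Measurable (r v) := fun v => (Measure.measurable_rnDeriv _ _).ennreal_toReal
  have hri : ∀ v, Integrable (r v) μ := fun v => Measure.integrable_toReal_rnDeriv
  let g : X → Matrix (Fin d) (Fin d) ℂ := fun x => .of fun i j =>
    (1 / 4 : ℂ) * ∑ k : Fin 4, conj (Complex.I ^ (k : ℕ)) * (r (p i j k) x : ℂ)
  have hgm : ∀ i j, Measurable fun x => g x i j := fun i j => by
    simp only [g, Matrix.of_apply]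
    exact (Finset.measurable_fun_sum _ fun k _ =>
      (Complex.measurable_ofReal.comp (hrm _)).const_mul _).const_mul _
  have hgi : ∀ i j, Integrable (fun x => g x i j) μ := fun i j => by
    simp only [g, Matrix.of_apply]
    exact (integrable_finsetSum _ fun k _ => (hri _).ofReal.const_mul _).const_mul _
  have hbd : ∀ (φ : C(X, ℂ)) i j, Integrable (fun x => φ x * g x i j) μ := fun φ i j =>
    (hgi i j).bdd_mul (c := ‖φ‖) φ.continuous.aestronglyMeasurable
      (Eventually.of_forall φ.norm_coe_le_norm)
  have hbW : ∀ (φ : C(X, ℂ)) n i j, Integrable (fun a => φ (s a) * W n a i j) lam :=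
    fun φ n i j => (hWi n i j).bdd_mul (c := ‖φ‖)
      (φ.continuous.measurable.comp hs).aestronglyMeasurable
      (Eventually.of_forall fun a => φ.norm_coe_le_norm (s a))
  let cst : C(X, ℝ) → C(X, ℂ) := fun φ => ⟨fun x => (φ x : ℂ), by fun_prop⟩
  have hbdR : ∀ (φ : C(X, ℝ)) i j, Integrable (fun x => (φ x : ℂ) * g x i j) μ :=
    fun φ => hbd (cst φ)
  have hbWR : ∀ (φ : C(X, ℝ)) n i j, Integrable (fun a => (φ (s a) : ℂ) * W n a i j) lam :=
    fun φ => hbW (cst φ)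
  have hreal : ∀ (φ : C(X, ℝ)) i j, Tendsto (fun n => ∫ a, (φ (s a) : ℂ) * W n a i j ∂lam) U
      (𝓝 (∫ x, (φ x : ℂ) * g x i j ∂μ)) := by
    intro φ i j
    have e1 : ∀ n, ∫ a, (φ (s a) : ℂ) * W n a i j ∂lam = (1 / 4 : ℂ) * ∑ k : Fin 4,
        conj (Complex.I ^ (k : ℕ)) *
          ((∫ a, φ (s a) * ((W n a).quadForm (p i j k)).re ∂lam : ℝ) : ℂ) := by
      intro n
      have hI : ∀ k, Integrable (fun a => (φ (s a) : ℂ) * (W n a).quadForm (p i j k)) lam :=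
        fun k => integrable_mul_quadForm (κ := fun a => (φ (s a) : ℂ))
          (fun i j => hbWR φ n i j) _
      calc ∫ a, (φ (s a) : ℂ) * W n a i j ∂lam
          = ∫ a, (1 / 4 : ℂ) * ∑ k : Fin 4, conj (Complex.I ^ (k : ℕ)) *
              ((φ (s a) : ℂ) * (W n a).quadForm (p i j k)) ∂lam := by
            congr 1
            ext a
            rw [Matrix.polarization (W n a) i j, mul_left_comm, Finset.mul_sum]
            simp only [mul_left_comm (φ (s a) : ℂ), hp]
        _ = _ := by
            rw [integral_const_mul, integral_finsetSum _ fun k _ => (hI k).const_mul _]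
            congr 1
            refine Finset.sum_congr rfl fun k _ => ?_
            rw [integral_const_mul, ← integral_complex_ofReal]
            simp only [Complex.ofReal_mul, hQr]
    have e2 : ∫ x, (φ x : ℂ) * g x i j ∂μ = (1 / 4 : ℂ) * ∑ k : Fin 4,
        conj (Complex.I ^ (k : ℕ)) * ((∫ x, φ x ∂(m (p i j k)) : ℝ) : ℂ) := by
      have hI : ∀ k, Integrable (fun x => (φ x : ℂ) * (r (p i j k) x : ℂ)) μ := fun k =>
        (hri (p i j k)).ofReal.bdd_mul (c := ‖φ‖)
          (Complex.continuous_ofReal.comp φ.continuous).aestronglyMeasurable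
          (Eventually.of_forall fun x => by simpa using φ.norm_coe_le_norm x)
      calc ∫ x, (φ x : ℂ) * g x i j ∂μ
          = ∫ x, (1 / 4 : ℂ) * ∑ k : Fin 4, conj (Complex.I ^ (k : ℕ)) *
              ((φ x : ℂ) * (r (p i j k) x : ℂ)) ∂μ := by
            congr 1
            ext x
            simp only [g, Matrix.of_apply]
            rw [mul_left_comm, Finset.mul_sum]
            simp only [mul_left_comm (φ x : ℂ)]
        _ = _ := by
            rw [integral_const_mul, integral_finsetSum _ fun k _ => (hI k).const_mul _]
            congr 1
            refine Finset.sum_congr rfl fun k _ => ?_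
            rw [integral_const_mul, ← integral_rnDeriv_smul (hle i j k), ← integral_complex_ofReal]
            simp only [Complex.ofReal_mul, smul_eq_mul, mul_comm, r]
    rw [e2]
    simp only [e1]
    exact (tendsto_finsetSum _ fun k _ =>
      ((Complex.continuous_ofReal.tendsto _).comp (hm (p i j k) φ)).const_mul _).const_mul _
  have hquad : ∀ (φ : C(X, ℝ)), 0 ≤ φ → ∀ v, 0 ≤ ∫ x, (φ x : ℂ) * (g x).quadForm v ∂μ := by
    intro φ hφ v
    rw [integral_mul_quadForm (κ := fun x => (φ x : ℂ)) (fun i j => hbdR φ i j)]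
    have ht : Tendsto (fun n => Matrix.quadForm
        (.of fun i j => ∫ a, (φ (s a) : ℂ) * W n a i j ∂lam) v) U
        (𝓝 (Matrix.quadForm (.of fun i j => ∫ x, (φ x : ℂ) * g x i j ∂μ) v)) :=
      tendsto_finsetSum _ fun i _ => tendsto_finsetSum _ fun j _ =>
        ((hreal φ i j).const_mul _).mul_const _
    refine ge_of_tendsto' ht fun n => ?_
    refine Matrix.posSemidef_iff_quadForm.1 (posSemidef_integral_mul
      (fun i j => hbWR φ n i j) (Eventually.of_forall fun a => ?_)
      (Eventually.of_forall (hW n))) v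
    simpa using hφ (s a)
  have hae : ∀ v, ∀ᵐ x ∂μ, 0 ≤ (g x).quadForm v := by
    intro v
    have hI := integrable_quadForm hgi v
    have hIφ : ∀ φ : C(X, ℝ), Integrable (fun x => (φ x : ℂ) * (g x).quadForm v) μ := fun φ =>
      integrable_mul_quadForm (κ := fun x => (φ x : ℂ)) (fun i j => hbdR φ i j) v
    have hre : ∀ φ : C(X, ℝ), ∫ x, φ x * ((g x).quadForm v).re ∂μ =
        (∫ x, (φ x : ℂ) * (g x).quadForm v ∂μ).re := fun φ => by
      rw [← RCLike.re_eq_complex_re, ← integral_re (hIφ φ)]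
      simp
    have him : ∀ φ : C(X, ℝ), ∫ x, φ x * ((g x).quadForm v).im ∂μ =
        (∫ x, (φ x : ℂ) * (g x).quadForm v ∂μ).im := fun φ => by
      rw [← RCLike.im_eq_complex_im, ← integral_im (hIφ φ)]
      simp
    have h1 := ae_nonneg_of_forall_integral_mul_nonneg hI.re fun φ hφ => by
      have := (Complex.nonneg_iff.1 (hquad φ.toContinuousMap hφ v)).1
      rw [← hre] at this
      exact this
    have h2 := ae_nonneg_of_forall_integral_mul_nonneg hI.im fun φ hφ => by
      have := (Complex.nonneg_iff.1 (hquad φ.toContinuousMap hφ v)).2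
      rw [← him] at this
      exact this.le
    have h3 := ae_nonneg_of_forall_integral_mul_nonneg hI.im.neg fun φ hφ => by
      have := (Complex.nonneg_iff.1 (hquad φ.toContinuousMap hφ v)).2
      rw [← him] at this
      have h4 : ∫ x, φ x * -((g x).quadForm v).im ∂μ = 0 := by
        simp only [mul_neg, integral_neg, neg_eq_zero]
        exact this.symm
      exact h4.ge
    filter_upwards [h1, h2, h3] with x h1 h2 h3
    refine Complex.nonneg_iff.2 ⟨h1, le_antisymm h2 ?_⟩
    simpa using h3
  refine ⟨μ, g, hμfin, hgm, hgi, ?_, fun φ i j => ?_⟩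
  · have hall := ae_all_iff.2 fun n => hae (TopologicalSpace.denseSeq (Fin d → ℂ) n)
    filter_upwards [hall] with x hx
    rw [Matrix.posSemidef_iff_quadForm]
    have hc : IsClosed {v | 0 ≤ (g x).quadForm v} := by
      refine isClosed_le continuous_const ?_
      unfold Matrix.quadForm
      fun_prop
    intro v
    exact hc.closure_subset_iff.2 (Set.range_subset_iff.2 hx)
      (TopologicalSpace.denseRange_denseSeq _ v)
  · let φ₁ : C(X, ℝ) := ⟨fun x => (φ x).re, by fun_prop⟩
    let φ₂ : C(X, ℝ) := ⟨fun x => (φ x).im, by fun_prop⟩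
    have hφ : ∀ x, φ x = (φ₁ x : ℂ) + (φ₂ x : ℂ) * Complex.I := fun x =>
      (Complex.re_add_im _).symm
    have e1 : ∀ n, ∫ a, φ (s a) * W n a i j ∂lam = ∫ a, (φ₁ (s a) : ℂ) * W n a i j ∂lam +
        Complex.I * ∫ a, (φ₂ (s a) : ℂ) * W n a i j ∂lam := fun n => by
      rw [← integral_const_mul, ← integral_add (hbWR φ₁ n i j)
        ((hbWR φ₂ n i j).const_mul _)]
      exact integral_congr_ae (Eventually.of_forall fun a => by simp only [hφ]; ring)
    have e2 : ∫ x, φ x * g x i j ∂μ = ∫ x, (φ₁ x : ℂ) * g x i j ∂μ +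
        Complex.I * ∫ x, (φ₂ x : ℂ) * g x i j ∂μ := by
      rw [← integral_const_mul, ← integral_add (hbdR φ₁ i j)
        ((hbdR φ₂ i j).const_mul _)]
      exact integral_congr_ae (Eventually.of_forall fun a => by simp only [hφ]; ring)
    rw [e2]
    simp only [e1]
    exact (hreal φ₁ i j).add ((hreal φ₂ i j).const_mul _)

end

theorem Complex.affine_mem_slitPlane {z : ℂ} (hz : z ∈ Complex.slitPlane) {s : ℝ}
    (hs : s ∈ Set.Icc (0 : ℝ) 1) : 1 - (s : ℂ) + s * z ∈ Complex.slitPlane := by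
  have := Complex.starConvex_one_slitPlane hz (sub_nonneg.2 hs.2) hs.1 (by ring)
  simpa using this

theorem Complex.affine_ne_zero {z : ℂ} (hz : z ∈ Complex.slitPlane) {s : ℝ}
    (hs : s ∈ Set.Icc (0 : ℝ) 1) : 1 - (s : ℂ) + s * z ≠ 0 :=
  Complex.slitPlane_ne_zero (Complex.affine_mem_slitPlane hz hs)

/-- The conformal map `ζ ↦ ((1 + ζ) / (1 - ζ))²` of the unit disc onto the slit plane. -/
noncomputable def koebeMap (ζ : ℂ) : ℂ := ((1 + ζ) / (1 - ζ)) ^ 2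

theorem one_sub_ne_zero_of_norm_lt {ζ : ℂ} (h : ‖ζ‖ < 1) : 1 - ζ ≠ 0 := by
  intro h0
  rw [← sub_eq_zero.1 h0] at h
  simp at h

theorem koebeMap_zero : koebeMap 0 = 1 := by simp [koebeMap]

theorem koebeMap_conj (ζ : ℂ) : koebeMap (conj ζ) = conj (koebeMap ζ) := by
  simp [koebeMap]

theorem re_cayley_pos {ζ : ℂ} (h : ‖ζ‖ < 1) : 0 < ((1 + ζ) / (1 - ζ)).re := by
  have h1 := one_sub_ne_zero_of_norm_lt h
  have h2 : Complex.normSq ζ < 1 := by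
    rw [Complex.normSq_eq_norm_sq]
    nlinarith [norm_nonneg ζ]
  rw [Complex.normSq_apply] at h2
  rw [Complex.div_re, ← add_div]
  refine div_pos ?_ (Complex.normSq_pos.2 h1)
  simp
  nlinarith

theorem koebeMap_mem_slitPlane {ζ : ℂ} (h : ‖ζ‖ < 1) : koebeMap ζ ∈ Complex.slitPlane := by
  have hp := re_cayley_pos h
  rw [koebeMap, Complex.mem_slitPlane_iff]
  set w := (1 + ζ) / (1 - ζ)
  by_cases him : w.im = 0
  · left
    simp [sq, him]
    positivity
  · right
    simp [sq]
    intro h0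
    have : w.re * w.im = 0 := by linarith
    rcases mul_eq_zero.1 this with h | h
    exacts [hp.ne' h, him h]

theorem exists_koebeMap_eq {z : ℂ} (hz : z ∈ Complex.slitPlane) :
    ∃ ζ : ℂ, ‖ζ‖ < 1 ∧ koebeMap ζ = z := by
  obtain ⟨w, hw, hwz⟩ : ∃ w : ℂ, 0 < w.re ∧ w ^ 2 = z := by
    refine ⟨z ^ (1 / 2 : ℂ), ?_, by rw [← Complex.cpow_nat_mul]; simp⟩
    have hz0 := Complex.slitPlane_ne_zero hz
    have harg := Complex.mem_slitPlane_iff_arg.1 hz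
    rw [Complex.cpow_def_of_ne_zero hz0, Complex.exp_re]
    refine mul_pos (Real.exp_pos _) (Real.cos_pos_of_mem_Ioo ?_)
    have e : (Complex.log z * (1 / 2 : ℂ)).im = z.arg / 2 := by
      rw [show (1 / 2 : ℂ) = ((1 / 2 : ℝ) : ℂ) by norm_num, Complex.im_mul_ofReal,
        Complex.log_im]
      ring
    rw [e]
    have := Complex.neg_pi_lt_arg z
    have := lt_of_le_of_ne (Complex.arg_le_pi z) harg.1
    constructor <;> linarith
  have hw1 : w + 1 ≠ 0 := fun h => by
    have := congrArg Complex.re h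
    simp at this
    linarith
  refine ⟨(w - 1) / (w + 1), ?_, ?_⟩
  · rw [norm_div, div_lt_one (norm_pos_iff.2 hw1), ← sq_lt_sq₀ (norm_nonneg _) (norm_nonneg _),
      ← Complex.normSq_eq_norm_sq, ← Complex.normSq_eq_norm_sq, Complex.normSq_apply,
      Complex.normSq_apply]
    simp
    nlinarith
  · rw [koebeMap, ← hwz]
    congr 1
    field_simp
    ring

theorem differentiableOn_koebeMap : DifferentiableOn ℂ koebeMap (Metric.ball 0 1) := by
  intro ζ hζ
  have := one_sub_ne_zero_of_norm_lt (mem_ball_zero_iff.1 hζ)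
  unfold koebeMap
  fun_prop (disch := assumption)

theorem koebeMap_im_eq_pos_mul {ζ : ℂ} (h : ‖ζ‖ < 1) :
    ∃ c : ℝ, 0 < c ∧ (koebeMap ζ).im = c * ζ.im := by
  have hp := re_cayley_pos h
  have h1 := one_sub_ne_zero_of_norm_lt h
  refine ⟨4 * ((1 + ζ) / (1 - ζ)).re / Complex.normSq (1 - ζ),
    div_pos (by linarith) (Complex.normSq_pos.2 h1), ?_⟩
  have e : (koebeMap ζ).im = 2 * ((1 + ζ) / (1 - ζ)).re * ((1 + ζ) / (1 - ζ)).im := by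
    rw [koebeMap, sq, Complex.mul_im]
    ring
  have e2 : ((1 + ζ) / (1 - ζ)).im = 2 * ζ.im / Complex.normSq (1 - ζ) := by
    rw [Complex.div_im, ← sub_div]
    congr 1
    simp
    ring
  rw [e, e2]
  ring

/-- The kernel `(z - 1) / (1 - s + s z)` pulled back to the circle is a Cauchy-type kernel. -/
theorem koebe_kernel_eq {u ζ : ℂ} (hu : ‖u‖ = 1) (hζ : ‖ζ‖ < 1) :
    (koebeMap ζ - 1) / (1 - ((1 - u.re) / 2 : ℝ) + ((1 - u.re) / 2 : ℝ) * koebeMap ζ) *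
      (u.im / (4 * Complex.I)) = 1 / 2 * (u / (u - ζ) - 1 / (1 - ζ * u)) := by
  have hs : (1 - u.re) / 2 ∈ Set.Icc (0 : ℝ) 1 := by
    have := abs_le.1 ((Complex.abs_re_le_norm u).trans_eq hu)
    constructor <;> linarith [this.1, this.2]
  have hD := Complex.affine_ne_zero (koebeMap_mem_slitPlane hζ) hs
  have h1 := one_sub_ne_zero_of_norm_lt hζ
  have h2 : u - ζ ≠ 0 := fun h => by
    rw [← sub_eq_zero.1 h, hu] at hζ
    exact lt_irrefl _ hζ
  have h3 : 1 - ζ * u ≠ 0 := one_sub_ne_zero_of_norm_lt (by rw [norm_mul, hu, mul_one]; exact hζ)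
  have hu0 : u ≠ 0 := fun h => by simp [h] at hu
  have hbar : conj u = u⁻¹ := (Complex.inv_eq_conj hu).symm
  have hre : (u.re : ℂ) = (u + u⁻¹) / 2 := by rw [← hbar, Complex.re_eq_add_conj]
  have him : (u.im : ℂ) = (u - u⁻¹) / (2 * Complex.I) := by rw [← hbar, Complex.im_eq_sub_conj]
  have hI : Complex.I ≠ 0 := Complex.I_ne_zero
  have key : 1 - (((1 - u.re) / 2 : ℝ) : ℂ) + ((1 - u.re) / 2 : ℝ) * koebeMap ζ =
      (u - ζ) * (1 - ζ * u) / (u * (1 - ζ) ^ 2) := by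
    push_cast
    rw [hre, koebeMap]
    field_simp
    ring
  have key2 : koebeMap ζ - 1 = 4 * ζ / (1 - ζ) ^ 2 := by
    rw [koebeMap]
    field_simp
    ring
  rw [key, key2, him]
  field_simp
  rw [Complex.I_sq]
  ring

theorem circleAverage_kernel {h₁ h₂ : ℂ → ℂ} {R : ℝ} (hR : 1 < R)
    (d₁ : DifferentiableOn ℂ h₁ (Metric.ball 0 R)) (d₂ : DifferentiableOn ℂ h₂ (Metric.ball 0 R))
    {ζ : ℂ} (hζ : ‖ζ‖ < 1) :
    Real.circleAverage (fun u => (u / (u - ζ) - 1 / (1 - ζ * u)) * (h₁ u - conj (h₂ u))) 0 1 =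
      h₁ ζ - h₁ 0 - conj (h₂ 0) + conj (h₂ (conj ζ)) := by
  have hsub : Metric.closedBall (0 : ℂ) 1 ⊆ Metric.ball 0 R := Metric.closedBall_subset_ball hR
  have cauchy : ∀ h : ℂ → ℂ, DifferentiableOn ℂ h (Metric.ball 0 R) → ∀ ξ : ℂ, ‖ξ‖ < 1 →
      Real.circleAverage (fun u => u / (u - ξ) * h u) 0 1 = h ξ := by
    intro h hd ξ hξ
    have hdc : DiffContOnCl ℂ h (Metric.ball 0 |1|) := by
      rw [abs_one]
      exact (hd.mono (by rw [closure_ball _ one_ne_zero]; exact hsub)).diffContOnCl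
    simpa using hdc.circleAverage_smul_div (w := ξ) (by simpa using hξ)
  have mean : ∀ h : ℂ → ℂ, DifferentiableOn ℂ h (Metric.ball 0 R) → ∀ ξ : ℂ, ‖ξ‖ < 1 →
      Real.circleAverage (fun u => 1 / (1 - ξ * u) * h u) 0 1 = h 0 := by
    intro h hd ξ hξ
    have hd' : DifferentiableOn ℂ (fun u => 1 / (1 - ξ * u) * h u) (Metric.closedBall 0 1) := by
      refine DifferentiableOn.mul ?_ (hd.mono hsub)
      refine DifferentiableOn.div (by fun_prop) (by fun_prop) fun u hu => ?_
      refine one_sub_ne_zero_of_norm_lt ?_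
      rw [norm_mul]
      have := mem_closedBall_zero_iff.1 hu
      nlinarith [norm_nonneg ξ, norm_nonneg u]
    have hdc : DiffContOnCl ℂ (fun u => 1 / (1 - ξ * u) * h u) (Metric.ball 0 |1|) := by
      rw [abs_one]
      exact (hd'.mono (by rw [closure_ball _ one_ne_zero])).diffContOnCl
    simpa using hdc.circleAverage
  have hsph : ∀ {u : ℂ}, u ∈ Metric.sphere (0 : ℂ) |1| → ‖u‖ = 1 := fun hu => by simpa using hu
  have k1 : ∀ ξ : ℂ, ‖ξ‖ < 1 →
      ContinuousOn (fun u : ℂ => u / (u - ξ)) (Metric.sphere 0 |1|) := fun ξ hξ =>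
    ContinuousOn.div (by fun_prop) (by fun_prop) fun u hu h => by
      rw [← sub_eq_zero.1 h, hsph hu] at hξ
      exact lt_irrefl _ hξ
  have k2 : ∀ ξ : ℂ, ‖ξ‖ < 1 →
      ContinuousOn (fun u : ℂ => 1 / (1 - ξ * u)) (Metric.sphere 0 |1|) := fun ξ hξ =>
    ContinuousOn.div (by fun_prop) (by fun_prop) fun u hu =>
      one_sub_ne_zero_of_norm_lt (by rw [norm_mul, hsph hu, mul_one]; exact hξ)
  have hsphb : Metric.sphere (0 : ℂ) |1| ⊆ Metric.ball 0 R := by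
    rw [abs_one]; exact Metric.sphere_subset_closedBall.trans hsub
  have c₁ := d₁.continuousOn.mono hsphb
  have c₂ := d₂.continuousOn.mono hsphb
  have cc₂ : ContinuousOn (fun u => conj (h₂ u)) (Metric.sphere 0 |1|) :=
    Complex.continuous_conj.comp_continuousOn c₂
  have hζ' : ‖conj ζ‖ < 1 := by rwa [RCLike.norm_conj]
  have conjavg : ∀ f : ℂ → ℂ, ContinuousOn f (Metric.sphere 0 |1|) →
      Real.circleAverage (fun u => conj (f u)) 0 1 = conj (Real.circleAverage f 0 1) := by
    intro f hf
    exact ContinuousLinearMap.circleAverage_comp_comm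
      (Complex.conjCLE : ℂ →L[ℝ] ℂ) hf.circleIntegrable'
  have e3 : Real.circleAverage (fun u => u / (u - ζ) * conj (h₂ u)) 0 1 = conj (h₂ 0) := by
    rw [← mean h₂ d₂ (conj ζ) hζ',
      ← conjavg (fun u => 1 / (1 - conj ζ * u) * h₂ u) ((k2 _ hζ').mul c₂)]
    refine Real.circleAverage_congr_sphere fun u hu => ?_
    have hu1 := hsph hu
    have hu0 : u ≠ 0 := fun h => by simp [h] at hu1
    simp only [map_mul, map_div₀, map_sub, map_one, Complex.conj_conj]
    rw [(Complex.inv_eq_conj hu1).symm]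
    congr 1
    have h2 : u - ζ ≠ 0 := fun h => by
      rw [← sub_eq_zero.1 h, hu1] at hζ
      exact lt_irrefl _ hζ
    have h3 : 1 - ζ * u⁻¹ ≠ 0 := by
      rw [← div_eq_mul_inv, one_sub_div hu0]
      exact div_ne_zero h2 hu0
    field_simp
  have e4 : Real.circleAverage (fun u => 1 / (1 - ζ * u) * conj (h₂ u)) 0 1 =
      conj (h₂ (conj ζ)) := by
    rw [← cauchy h₂ d₂ (conj ζ) hζ',
      ← conjavg (fun u => u / (u - conj ζ) * h₂ u) ((k1 _ hζ').mul c₂)]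
    refine Real.circleAverage_congr_sphere fun u hu => ?_
    have hu1 := hsph hu
    have hu0 : u ≠ 0 := fun h => by simp [h] at hu1
    simp only [map_mul, map_div₀, map_sub, Complex.conj_conj]
    rw [(Complex.inv_eq_conj hu1).symm]
    congr 1
    have h3 : 1 - ζ * u ≠ 0 := one_sub_ne_zero_of_norm_lt (by rw [norm_mul, hu1, mul_one]; exact hζ)
    have h4 : u⁻¹ - ζ ≠ 0 := by
      have : u⁻¹ - ζ = (1 - ζ * u) * u⁻¹ := by field_simp
      rw [this]
      exact mul_ne_zero h3 (inv_ne_zero hu0)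
    field_simp
  have i₁ : CircleIntegrable (fun u => u / (u - ζ) * h₁ u) 0 1 :=
    ((k1 ζ hζ).mul c₁).circleIntegrable'
  have i₂ : CircleIntegrable (fun u => 1 / (1 - ζ * u) * h₁ u) 0 1 :=
    ((k2 ζ hζ).mul c₁).circleIntegrable'
  have i₃ : CircleIntegrable (fun u => u / (u - ζ) * conj (h₂ u)) 0 1 :=
    ((k1 ζ hζ).mul cc₂).circleIntegrable'
  have i₄ : CircleIntegrable (fun u => 1 / (1 - ζ * u) * conj (h₂ u)) 0 1 :=
    ((k2 ζ hζ).mul cc₂).circleIntegrable'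
  have e1 := cauchy h₁ d₁ ζ hζ
  have e2 := mean h₁ d₁ ζ hζ
  rw [← e1, ← e2, ← e3, ← e4, ← Real.circleAverage_sub i₁ i₂,
    ← Real.circleAverage_sub (i₁.sub i₂) i₃,
    ← Real.circleAverage_add ((i₁.sub i₂).sub i₃) i₄]
  exact Real.circleAverage_congr_sphere fun u _ => by simp; ring

section Representation

variable {d : ℕ} {F : ℂ → Matrix (Fin d) (Fin d) ℂ}

/-- Schwarz reflection: `F (conj z) = (F z)ᴴ`. -/
theorem conj_apply_conj_of_posSemidef
    (hF : ∀ i j, DifferentiableOn ℂ (fun z => F z i j) Complex.slitPlane)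
    (hpos : ∀ x : ℝ, 0 < x → (F (x : ℂ)).PosSemidef) {z : ℂ} (hz : z ∈ Complex.slitPlane)
    (i j : Fin d) : conj (F (conj z) j i) = F z i j := by
  have hconj : ∀ w ∈ Complex.slitPlane, conj w ∈ Complex.slitPlane := fun w hw => by
    simpa [Complex.mem_slitPlane_iff] using hw
  have hd : DifferentiableOn ℂ (fun z => conj (F (conj z) j i)) Complex.slitPlane := by
    intro w hw
    have := ((hF j i).differentiableAt
      (Complex.isOpen_slitPlane.mem_nhds (hconj w hw)))
    have h := this.conj_conj
    rw [Complex.conj_conj] at h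
    exact h.differentiableWithinAt
  refine (hd.analyticOnNhd Complex.isOpen_slitPlane).eqOn_of_preconnected_of_frequently_eq
    ((hF i j).analyticOnNhd Complex.isOpen_slitPlane)
    (Complex.starConvex_one_slitPlane.isPathConnected (by simp)).isConnected.isPreconnected
    (z₀ := 1) (by simp) ?_ hz
  have ht : Tendsto (fun x : ℝ => (x : ℂ)) (𝓝[≠] 1) (𝓝[≠] 1) := by
    refine tendsto_nhdsWithin_iff.2 ⟨?_, ?_⟩
    · exact (Complex.continuous_ofReal.tendsto' 1 1 (by simp)).mono_left nhdsWithin_le_nhds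
    · filter_upwards [self_mem_nhdsWithin] with x hx
      simpa using hx
  refine ht.frequently (Eventually.frequently ?_)
  filter_upwards [mem_nhdsWithin_of_mem_nhds (lt_mem_nhds one_pos)] with x hx
  have := (hpos x hx).isHermitian.apply i j
  simpa using this

/-- The positive matrix density on the circle of radius `r` attached to `F ∘ koebeMap`. -/
noncomputable def koebeDensity (F : ℂ → Matrix (Fin d) (Fin d) ℂ) (r θ : ℝ) :
    Matrix (Fin d) (Fin d) ℂ :=
  (((2 * Real.pi)⁻¹ : ℝ) * ((circleMap 0 1 θ).im / (4 * Complex.I)) : ℂ) •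
    (F (koebeMap (r * circleMap 0 1 θ)) - (F (koebeMap (r * circleMap 0 1 θ)))ᴴ)

theorem norm_ofReal_mul_circleMap_lt {r : ℝ} (hr : r ∈ Set.Ioo (0 : ℝ) 1) (θ : ℝ) :
    ‖(r : ℂ) * circleMap 0 1 θ‖ < 1 := by
  simp [abs_of_pos hr.1, hr.2]

theorem posSemidef_koebeDensity
    (him : ∀ z ∈ Complex.slitPlane, z.im ≠ 0 → ((z - conj z)⁻¹ • (F z - (F z)ᴴ)).PosSemidef)
    {r : ℝ} (hr : r ∈ Set.Ioo (0 : ℝ) 1) (θ : ℝ) : (koebeDensity F r θ).PosSemidef := by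
  have hn := norm_ofReal_mul_circleMap_lt hr θ
  obtain ⟨c, hc, hcz⟩ := koebeMap_im_eq_pos_mul hn
  unfold koebeDensity
  have hz := koebeMap_mem_slitPlane hn
  set z := koebeMap (r * circleMap 0 1 θ)
  rw [Complex.im_ofReal_mul] at hcz
  rcases eq_or_ne (circleMap 0 1 θ).im 0 with h0 | h0
  · simpa [h0] using Matrix.PosSemidef.zero
  have hzim : z.im ≠ 0 := by
    rw [hcz]
    exact mul_ne_zero hc.ne' (mul_ne_zero hr.1.ne' h0)
  have hsub : z - conj z = 2 * z.im * Complex.I := by rw [Complex.sub_conj]; push_cast; ring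
  have hne : z - conj z ≠ 0 := by
    rw [hsub]
    simpa using hzim
  have hP := him z hz hzim
  rw [← smul_inv_smul₀ hne (F z - (F z)ᴴ), smul_smul]
  refine hP.smul ?_
  have e : (((2 * Real.pi)⁻¹ : ℝ) * ((circleMap 0 1 θ).im / (4 * Complex.I)) : ℂ) * (z - conj z) =
      ((2 * Real.pi)⁻¹ * (c * r * (circleMap 0 1 θ).im ^ 2 / 2) : ℝ) := by
    rw [hsub, hcz]
    have := Complex.I_ne_zero
    push_cast
    field_simp
    ring
  rw [e, Complex.zero_le_real]
  have := hr.1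
  positivity

theorem continuous_koebeDensity
    (hF : ∀ i j, DifferentiableOn ℂ (fun z => F z i j) Complex.slitPlane)
    {r : ℝ} (hr : r ∈ Set.Ioo (0 : ℝ) 1) (i j : Fin d) :
    Continuous fun θ => koebeDensity F r θ i j := by
  have hz : Continuous fun θ : ℝ => koebeMap (r * circleMap 0 1 θ) :=
    differentiableOn_koebeMap.continuousOn.comp_continuous
      (continuous_const.mul (continuous_circleMap 0 1))
      fun θ => mem_ball_zero_iff.2 (norm_ofReal_mul_circleMap_lt hr θ)
  have hc : ∀ k l, Continuous fun θ : ℝ => F (koebeMap (r * circleMap 0 1 θ)) k l := fun k l =>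
    (hF k l).continuousOn.comp_continuous hz
      fun θ => koebeMap_mem_slitPlane (norm_ofReal_mul_circleMap_lt hr θ)
  have hi : Continuous fun θ : ℝ => ((circleMap 0 1 θ).im : ℂ) :=
    Complex.continuous_ofReal.comp (Complex.continuous_im.comp (continuous_circleMap 0 1))
  simp only [koebeDensity, Matrix.smul_apply, Matrix.sub_apply, Matrix.conjTranspose_apply,
    smul_eq_mul]
  exact (continuous_const.mul (hi.div_const _)).mul
    ((hc i j).sub (Complex.continuous_conj.comp (hc j i)))

theorem integral_koebeDensity
    (hF : ∀ i j, DifferentiableOn ℂ (fun z => F z i j) Complex.slitPlane)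
    (hpos : ∀ x : ℝ, 0 < x → (F (x : ℂ)).PosSemidef) {r : ℝ} (hr : r ∈ Set.Ioo (0 : ℝ) 1)
    {ζ : ℂ} (hζ : ‖ζ‖ < 1) (i j : Fin d) :
    ∫ θ in Set.Ioc 0 (2 * Real.pi), (koebeMap ζ - 1) /
        (1 - ((1 - (circleMap 0 1 θ).re) / 2 : ℝ) +
          ((1 - (circleMap 0 1 θ).re) / 2 : ℝ) * koebeMap ζ) * koebeDensity F r θ i j =
      F (koebeMap (r * ζ)) i j - F 1 i j := by
  have hR : 1 < r⁻¹ := (one_lt_inv₀ hr.1).2 hr.2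
  have hd : ∀ k l, DifferentiableOn ℂ (fun u => F (koebeMap (r * u)) k l)
      (Metric.ball 0 r⁻¹) := by
    intro k l
    have hn : ∀ u ∈ Metric.ball (0 : ℂ) r⁻¹, ‖(r : ℂ) * u‖ < 1 := fun u hu => by
      rw [norm_mul, Complex.norm_real, Real.norm_of_nonneg hr.1.le]
      have := mul_lt_mul_of_pos_left (mem_ball_zero_iff.1 hu) hr.1
      rwa [mul_inv_cancel₀ hr.1.ne'] at this
    refine (hF k l).comp (t := Complex.slitPlane) ?_ fun u hu => koebeMap_mem_slitPlane (hn u hu)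
    refine differentiableOn_koebeMap.comp (by fun_prop) fun u hu => mem_ball_zero_iff.2 (hn u hu)
  have h := circleAverage_kernel hR (hd i j) (hd j i) hζ
  have hrζ : ‖(r : ℂ) * ζ‖ < 1 := by
    rw [norm_mul, Complex.norm_real, Real.norm_of_nonneg hr.1.le]
    nlinarith [norm_nonneg ζ, hr.1, hr.2]
  have h1 : conj (F 1 j i) = F 1 i j := by
    simpa using conj_apply_conj_of_posSemidef hF hpos (z := 1) (by simp) i j
  have h2 : conj (F (koebeMap (r * conj ζ)) j i) = F (koebeMap (r * ζ)) i j := by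
    have := conj_apply_conj_of_posSemidef hF hpos (koebeMap_mem_slitPlane hrζ) i j
    rw [← koebeMap_conj] at this
    simpa using this
  simp only [mul_zero, koebeMap_zero] at h
  rw [h1, h2, Real.circleAverage_def, intervalIntegral.integral_of_le (by positivity)] at h
  have e : F (koebeMap (r * ζ)) i j - F 1 i j = 1 / 2 *
      (F (koebeMap (r * ζ)) i j - F 1 i j - F 1 i j + F (koebeMap (r * ζ)) i j) := by ring
  rw [e, ← h, Complex.real_smul, ← mul_assoc, ← integral_const_mul]
  congr 1
  ext θ
  have hk := koebe_kernel_eq (u := circleMap 0 1 θ) (by simp) hζ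
  simp only [koebeDensity, Matrix.smul_apply, Matrix.sub_apply, Matrix.conjTranspose_apply,
    smul_eq_mul]
  rw [starRingEnd_apply]
  generalize F (koebeMap (r * circleMap 0 1 θ)) i j - star _ = D
  rw [mul_assoc (((2 * Real.pi)⁻¹ : ℝ) : ℂ), mul_left_comm, ← mul_assoc _ _ D, hk]
  push_cast
  ring

/-- The kernel `(z - 1) / (1 - s + s z)` as a continuous function of `s ∈ [0, 1]`. -/
noncomputable def affineKernel {z : ℂ} (hz : z ∈ Complex.slitPlane) :
    C(Set.Icc (0 : ℝ) 1, ℂ) where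
  toFun s := (z - 1) / (1 - ((s : ℝ) : ℂ) + ((s : ℝ) : ℂ) * z)
  continuous_toFun := by
    refine Continuous.div (by fun_prop) (by fun_prop) fun s => Complex.affine_ne_zero hz s.2

/-- The height of a point of the unit circle, normalised to `[0, 1]`. -/
noncomputable def circleHeight (θ : ℝ) : Set.Icc (0 : ℝ) 1 :=
  ⟨(1 - (circleMap 0 1 θ).re) / 2, by
    have := abs_le.1 ((Complex.abs_re_le_norm (circleMap 0 1 θ)).trans_eq
      (show ‖circleMap 0 1 θ‖ = 1 by simp))
    constructor <;> linarith [this.1, this.2]⟩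

theorem continuous_circleHeight : Continuous circleHeight :=
  Continuous.subtype_mk
    ((continuous_const.sub (Complex.continuous_re.comp (continuous_circleMap 0 1))).div_const 2) _

/-- Integral representation of a class S function over `[0, 1]`, normalised at `z = 1`. -/
theorem exists_representation_Icc
    (hF : ∀ i j, DifferentiableOn ℂ (fun z => F z i j) Complex.slitPlane)
    (him : ∀ z ∈ Complex.slitPlane, z.im ≠ 0 → ((z - conj z)⁻¹ • (F z - (F z)ᴴ)).PosSemidef)
    (hpos : ∀ x : ℝ, 0 < x → (F (x : ℂ)).PosSemidef) :
    ∃ (μ : Measure (Set.Icc (0 : ℝ) 1)) (g : Set.Icc (0 : ℝ) 1 → Matrix (Fin d) (Fin d) ℂ),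
      IsFiniteMeasure μ ∧ (∀ i j, Measurable fun x => g x i j) ∧
      (∀ i j, Integrable (fun x => g x i j) μ) ∧ (∀ᵐ x ∂μ, (g x).PosSemidef) ∧
      ∀ z ∈ Complex.slitPlane, ∀ i j, F z i j = F 1 i j +
        ∫ s, (z - 1) / (1 - ((s : ℝ) : ℂ) + ((s : ℝ) : ℂ) * z) * g s i j ∂μ := by
  set r : ℕ → ℝ := fun n => ((n : ℝ) + 1) / (n + 2) with hr_def
  have hr : ∀ n, r n ∈ Set.Ioo (0 : ℝ) 1 := fun n =>
    ⟨by positivity, (div_lt_one (by positivity)).2 (by linarith)⟩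
  have hr1 : Tendsto r atTop (𝓝 1) := by
    have h := tendsto_natCast_div_add_atTop (𝕜 := ℝ) (1 : ℝ)
    refine (h.comp (tendsto_add_atTop_nat 1)).congr fun n => ?_
    simp only [Function.comp, hr_def]
    push_cast
    ring
  have hlim : ∀ ζ : ℂ, ‖ζ‖ < 1 → ∀ i j,
      Tendsto (fun n => F (koebeMap (r n * ζ)) i j) atTop (𝓝 (F (koebeMap ζ) i j)) := by
    intro ζ hζ i j
    have c1 := (hF i j).continuousOn.continuousAt
      (Complex.isOpen_slitPlane.mem_nhds (koebeMap_mem_slitPlane hζ))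
    have c2 := differentiableOn_koebeMap.continuousOn.continuousAt
      (Metric.isOpen_ball.mem_nhds (mem_ball_zero_iff.2 hζ))
    refine Tendsto.comp c1 (Tendsto.comp c2 ?_)
    have : Tendsto (fun n => (r n : ℂ) * ζ) atTop (𝓝 (((1 : ℝ) : ℂ) * ζ)) :=
      ((Complex.continuous_ofReal.tendsto _).comp hr1).mul_const ζ
    simpa using this
  set lam := (volume : Measure ℝ).restrict (Set.Ioc 0 (2 * Real.pi)) with hlam
  have hint : ∀ f : ℝ → ℂ, Continuous f → Integrable f lam := fun f hf =>
    (hf.integrableOn_Icc (a := 0) (b := 2 * Real.pi)).mono_set Set.Ioc_subset_Icc_self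
  have hWi : ∀ n i j, Integrable (fun θ => koebeDensity F (r n) θ i j) lam := fun n i j =>
    hint _ (continuous_koebeDensity hF (hr n) i j)
  have hW : ∀ n θ, (koebeDensity F (r n) θ).PosSemidef := fun n θ =>
    posSemidef_koebeDensity him (hr n) θ
  have hrep : ∀ n {z ζ : ℂ} (hz : z ∈ Complex.slitPlane), ‖ζ‖ < 1 → koebeMap ζ = z → ∀ i j,
      ∫ θ, affineKernel hz (circleHeight θ) * koebeDensity F (r n) θ i j ∂lam =
        F (koebeMap (r n * ζ)) i j - F 1 i j := by
    intro n z ζ hz hζ e i j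
    rw [← integral_koebeDensity hF hpos (hr n) hζ i j]
    subst e
    rfl
  obtain ⟨C, hC⟩ : ∃ C : ℝ, ∀ n i, ∫ θ, (koebeDensity F (r n) θ i i).re ∂lam ≤ C := by
    have h2 : (2 : ℂ) ∈ Complex.slitPlane := by simp
    obtain ⟨ζ, hζ, hζ2⟩ := exists_koebeMap_eq h2
    have hb : ∀ i, ∃ c : ℝ, ∀ n, ‖F (koebeMap (r n * ζ)) i i - F 1 i i‖ ≤ c := fun i => by
      obtain ⟨c, hc⟩ := (((hlim ζ hζ i i).sub_const (F 1 i i)).norm).bddAbove_range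
      exact ⟨c, fun n => hc ⟨n, rfl⟩⟩
    choose c hc using hb
    have hc0 : ∀ i, 0 ≤ c i := fun i => (norm_nonneg _).trans (hc i 0)
    refine ⟨∑ i, 2 * c i, fun n i => le_trans ?_
      (Finset.single_le_sum (f := fun i => 2 * c i) (fun i _ => by linarith [hc0 i])
        (Finset.mem_univ i))⟩
    have hk : ∀ θ, affineKernel h2 (circleHeight θ) =
        ((1 + (circleHeight θ : ℝ))⁻¹ : ℝ) := fun θ => by
      simp only [affineKernel, ContinuousMap.coe_mk]
      push_cast
      rw [← one_div]
      congr 1 <;> ring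
    have hi2 : Integrable (fun θ => affineKernel h2 (circleHeight θ) *
        koebeDensity F (r n) θ i i) lam :=
      hint _ (((affineKernel h2).continuous.comp continuous_circleHeight).mul
        (continuous_koebeDensity hF (hr n) i i))
    have hle : ∫ θ, (koebeDensity F (r n) θ i i).re ∂lam ≤
        ∫ θ, 2 * (affineKernel h2 (circleHeight θ) * koebeDensity F (r n) θ i i).re ∂lam := by
      refine integral_mono (hWi n i i).re (hi2.re.const_mul 2) fun θ => ?_
      have h0 : 0 ≤ (koebeDensity F (r n) θ i i).re :=
        (Complex.nonneg_iff.1 ((hW n θ).diag_nonneg (i := i))).1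
      have hs := (circleHeight θ).2
      have : (1 : ℝ) / 2 ≤ (1 + (circleHeight θ : ℝ))⁻¹ := by
        rw [← one_div]
        exact one_div_le_one_div_of_le (by linarith [hs.1]) (by linarith [hs.2])
      simp only [hk, Complex.re_ofReal_mul]
      nlinarith
    refine hle.trans ?_
    rw [integral_const_mul]
    have := integral_re hi2
    simp only [RCLike.re_eq_complex_re] at this
    rw [this, hrep n h2 hζ hζ2 i i]
    have := (Complex.re_le_norm _).trans (hc i n)
    linarith
  obtain ⟨μ, g, hμ, hgm, hgi, hgp, hg⟩ := exists_matrix_density_limit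
    continuous_circleHeight.measurable hW hWi hC (hyperfilter ℕ)
  refine ⟨μ, g, hμ, hgm, hgi, hgp, fun z hz i j => ?_⟩
  obtain ⟨ζ, hζ, hζz⟩ := exists_koebeMap_eq hz
  have l1 := hg (affineKernel hz) i j
  have l2 := ((hlim ζ hζ i j).sub_const (F 1 i j)).mono_left Nat.hyperfilter_le_atTop
  rw [hζz] at l2
  have := tendsto_nhds_unique (l1.congr fun n => hrep n hz hζ hζz i j) l2
  rw [← sub_eq_iff_eq_add', ← this]
  rfl

end Representation

section Regularity

variable {d : ℕ} {μ : Measure (Set.Icc (0 : ℝ) 1)}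
  {g : Set.Icc (0 : ℝ) 1 → Matrix (Fin d) (Fin d) ℂ}

theorem affine_pos {x : ℝ} (hx : 0 < x) (s : Set.Icc (0 : ℝ) 1) :
    0 < 1 - (s : ℝ) + s * x := by
  have h1 := s.2.1
  have h2 := s.2.2
  rcases h1.eq_or_lt with h | h
  · rw [← h]; norm_num
  · have := mul_pos h hx
    linarith

/-- Fatou: a uniform bound as `x → 0` forces integrability against `(1 - s)⁻¹`. -/
theorem lintegral_mul_inv_one_sub_lt_top {w : Set.Icc (0 : ℝ) 1 → ℝ} (hw : Integrable w μ)
    (hw0 : 0 ≤ᵐ[μ] w) {M : ℝ}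
    (hM : ∀ x : ℝ, 0 < x → x < 1 →
      (1 - x) * ∫ s : Set.Icc (0 : ℝ) 1, (1 - (s : ℝ) + s * x)⁻¹ * w s ∂μ ≤ M) :
    ∫⁻ s, ENNReal.ofReal (w s) * (ENNReal.ofReal (1 - (s : ℝ)))⁻¹ ∂μ < ⊤ := by
  set x : ℕ → ℝ := fun n => 1 / ((n : ℝ) + 2) with hx
  have hx0 : ∀ n, 0 < x n := fun n => by positivity
  have hx1 : ∀ n, x n ≤ 1 / 2 := fun n => by
    simp only [hx]
    exact one_div_le_one_div_of_le (by norm_num) (by linarith [n.cast_nonneg (α := ℝ)])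
  have hxl : Tendsto x atTop (𝓝 0) := by
    have := (tendsto_one_div_add_atTop_nhds_zero_nat (𝕜 := ℝ)).comp (tendsto_add_atTop_nat 1)
    refine this.congr fun n => ?_
    simp only [Function.comp, hx]
    push_cast
    ring
  have hlim : ∀ s : Set.Icc (0 : ℝ) 1, Tendsto
      (fun n => ENNReal.ofReal (w s) * (ENNReal.ofReal (1 - (s : ℝ) + s * x n))⁻¹) atTop
      (𝓝 (ENNReal.ofReal (w s) * (ENNReal.ofReal (1 - (s : ℝ)))⁻¹)) := by
    intro s
    refine ENNReal.Tendsto.const_mul ?_ (Or.inr ENNReal.ofReal_ne_top)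
    refine tendsto_inv_iff.2 (ENNReal.tendsto_ofReal ?_)
    simpa using (hxl.const_mul (s : ℝ)).const_add (1 - (s : ℝ))
  have hbound : ∀ n, ∫⁻ s, ENNReal.ofReal (w s) *
      (ENNReal.ofReal (1 - (s : ℝ) + s * x n))⁻¹ ∂μ ≤ ENNReal.ofReal (2 * M) := by
    intro n
    have hc : Continuous fun s : Set.Icc (0 : ℝ) 1 => (1 - (s : ℝ) + s * x n)⁻¹ :=
      Continuous.inv₀ (by fun_prop) fun s => (affine_pos (hx0 n) s).ne'
    have hi : Integrable (fun s : Set.Icc (0 : ℝ) 1 => (1 - (s : ℝ) + s * x n)⁻¹ * w s) μ := by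
      obtain ⟨K, hK⟩ := isCompact_univ.exists_bound_of_continuousOn hc.continuousOn
      exact hw.bdd_mul hc.aestronglyMeasurable (ae_of_all _ fun s => hK s trivial)
    have hnn : 0 ≤ᵐ[μ] fun s : Set.Icc (0 : ℝ) 1 => (1 - (s : ℝ) + s * x n)⁻¹ * w s := by
      filter_upwards [hw0] with s hs
      exact mul_nonneg (inv_nonneg.2 (affine_pos (hx0 n) s).le) hs
    have e : ∫⁻ s, ENNReal.ofReal (w s) * (ENNReal.ofReal (1 - (s : ℝ) + s * x n))⁻¹ ∂μ =
        ENNReal.ofReal (∫ s, (1 - (s : ℝ) + s * x n)⁻¹ * w s ∂μ) := by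
      rw [ofReal_integral_eq_lintegral_ofReal hi hnn]
      refine lintegral_congr fun s => ?_
      rw [ENNReal.ofReal_mul (inv_nonneg.2 (affine_pos (hx0 n) s).le),
        ENNReal.ofReal_inv_of_pos (affine_pos (hx0 n) s), mul_comm]
    rw [e]
    refine ENNReal.ofReal_le_ofReal ?_
    have h0 := integral_nonneg_of_ae hnn
    have := hM (x n) (hx0 n) (by linarith [hx1 n])
    nlinarith [hx1 n]
  have hmeas : ∀ n, AEMeasurable (fun s : Set.Icc (0 : ℝ) 1 => ENNReal.ofReal (w s) *
      (ENNReal.ofReal (1 - (s : ℝ) + s * x n))⁻¹) μ := fun n =>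
    hw.aemeasurable.ennreal_ofReal.mul
      (Measurable.ennreal_ofReal (by fun_prop)).inv.aemeasurable
  calc ∫⁻ s, ENNReal.ofReal (w s) * (ENNReal.ofReal (1 - (s : ℝ)))⁻¹ ∂μ
      = ∫⁻ s, liminf (fun n => ENNReal.ofReal (w s) *
          (ENNReal.ofReal (1 - (s : ℝ) + s * x n))⁻¹) atTop ∂μ :=
        lintegral_congr fun s => (hlim s).liminf_eq.symm
    _ ≤ liminf (fun n => ∫⁻ s, ENNReal.ofReal (w s) *
          (ENNReal.ofReal (1 - (s : ℝ) + s * x n))⁻¹ ∂μ) atTop := lintegral_liminf_le' hmeas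
    _ ≤ ENNReal.ofReal (2 * M) := by
        refine liminf_le_of_frequently_le' (Frequently.of_forall hbound)
    _ < ⊤ := ENNReal.ofReal_lt_top

theorem inv_one_sub_regularity (hgi : ∀ i j, Integrable (fun s => g s i j) μ)
    (hgp : ∀ᵐ s ∂μ, (g s).PosSemidef) {M : Fin d → ℝ}
    (hM : ∀ i, ∀ x : ℝ, 0 < x → x < 1 →
      (1 - x) * ∫ s : Set.Icc (0 : ℝ) 1, (1 - (s : ℝ) + s * x)⁻¹ * (g s i i).re ∂μ ≤ M i) :
    (∀ᵐ s : Set.Icc (0 : ℝ) 1 ∂μ, (s : ℝ) = 1 → g s = 0) ∧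
      ∀ i j, Integrable (fun s : Set.Icc (0 : ℝ) 1 => (((1 - (s : ℝ))⁻¹ : ℝ) : ℂ) * g s i j) μ := by
  have hdiag : ∀ i, 0 ≤ᵐ[μ] fun s => (g s i i).re := fun i => by
    filter_upwards [hgp] with s hs
    exact (Complex.nonneg_iff.1 (hs.diag_nonneg (i := i))).1
  have hfin := fun i => lintegral_mul_inv_one_sub_lt_top (hgi i i).re (hdiag i) (hM i)
  simp only [RCLike.re_eq_complex_re] at hfin
  have hm : Measurable fun s : Set.Icc (0 : ℝ) 1 => (1 - (s : ℝ))⁻¹ := by fun_prop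
  have hreal : ∀ i, Integrable (fun s : Set.Icc (0 : ℝ) 1 => (1 - (s : ℝ))⁻¹ * (g s i i).re) μ := by
    intro i
    refine ⟨hm.aestronglyMeasurable.mul (hgi i i).re.aestronglyMeasurable, ?_⟩
    refine lt_of_le_of_lt (lintegral_mono_ae ?_) (hfin i)
    filter_upwards [hdiag i] with s hs
    have hs1 : 0 ≤ 1 - (s : ℝ) := sub_nonneg.2 s.2.2
    rw [Real.enorm_eq_ofReal (mul_nonneg (inv_nonneg.2 hs1) hs)]
    rcases hs1.eq_or_lt with h | h
    · rw [← h]; simp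
    · rw [ENNReal.ofReal_mul (inv_nonneg.2 hs1), ENNReal.ofReal_inv_of_pos h, mul_comm]
  constructor
  · have hlt : ∀ᵐ s ∂μ, ∀ i, ENNReal.ofReal ((g s i i).re) *
        (ENNReal.ofReal (1 - (s : ℝ)))⁻¹ < ⊤ := by
      rw [ae_all_iff]
      intro i
      refine ae_lt_top' ?_ (hfin i).ne
      exact (hgi i i).re.aemeasurable.ennreal_ofReal.mul
        (Measurable.ennreal_ofReal (by fun_prop)).inv.aemeasurable
    filter_upwards [hlt, hgp] with s h1 h2 hs
    have hz : ∀ i, (g s i i).re ≤ 0 := by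
      intro i
      have := h1 i
      rw [hs] at this
      by_contra! hneg
      simp [ENNReal.mul_top, hneg] at this
    ext i j
    have := h2.norm_apply_le i j
    have h0 : ‖g s i j‖ ≤ 0 := by linarith [hz i, hz j]
    simpa using h0
  · intro i j
    refine ((hreal i).add (hreal j)).mono' ?_ ?_
    · exact (Complex.continuous_ofReal.measurable.comp hm).aestronglyMeasurable.mul
        (hgi i j).aestronglyMeasurable
    · filter_upwards [hgp] with s hs
      have hs1 : 0 ≤ (1 - (s : ℝ))⁻¹ := inv_nonneg.2 (sub_nonneg.2 s.2.2)
      rw [norm_mul, Complex.norm_real, Real.norm_of_nonneg hs1]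
      have := mul_le_mul_of_nonneg_left (hs.norm_apply_le i j) hs1
      simpa [mul_add] using this

end Regularity

section Forward

theorem Continuous.integrable_mul_of_compactSpace {X : Type*} [TopologicalSpace X]
    [CompactSpace X] [MeasurableSpace X] [OpensMeasurableSpace X] {μ : Measure X} {φ h : X → ℂ}
    (hφ : Continuous φ) (hh : Integrable h μ) : Integrable (fun x => φ x * h x) μ := by
  obtain ⟨K, hK⟩ := isCompact_univ.exists_bound_of_continuousOn hφ.continuousOn
  exact hh.bdd_mul hφ.measurable.aestronglyMeasurable (ae_of_all _ fun s => hK s trivial)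

theorem Matrix.posSemidef_of_tendsto {d : ℕ} {M : ℕ → Matrix (Fin d) (Fin d) ℂ}
    {A : Matrix (Fin d) (Fin d) ℂ} (hM : ∀ n, (M n).PosSemidef)
    (h : ∀ i j, Tendsto (fun n => M n i j) atTop (𝓝 (A i j))) : A.PosSemidef := by
  rw [Matrix.posSemidef_iff_quadForm]
  intro v
  have ht : Tendsto (fun n => (M n).quadForm v) atTop (𝓝 (A.quadForm v)) :=
    tendsto_finsetSum _ fun i _ => tendsto_finsetSum _ fun j _ =>
      ((h i j).const_mul _).mul_const _
  exact ge_of_tendsto' ht fun n => Matrix.posSemidef_iff_quadForm.1 (hM n) v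

variable {d : ℕ} {F : ℂ → Matrix (Fin d) (Fin d) ℂ}

/-- Integral representation of a class S function over `[0, 1]`, normalised at `z = 0`. -/
theorem exists_representation_Icc_inv
    (hF : ∀ i j, DifferentiableOn ℂ (fun z => F z i j) Complex.slitPlane)
    (him : ∀ z ∈ Complex.slitPlane, z.im ≠ 0 → ((z - conj z)⁻¹ • (F z - (F z)ᴴ)).PosSemidef)
    (hpos : ∀ x : ℝ, 0 < x → (F (x : ℂ)).PosSemidef) :
    ∃ (A : Matrix (Fin d) (Fin d) ℂ) (μ : Measure (Set.Icc (0 : ℝ) 1))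
      (g : Set.Icc (0 : ℝ) 1 → Matrix (Fin d) (Fin d) ℂ),
      A.PosSemidef ∧ IsFiniteMeasure μ ∧ (∀ i j, Measurable fun x => g x i j) ∧
      (∀ i j, Integrable (fun x => g x i j) μ) ∧ (∀ᵐ x ∂μ, (g x).PosSemidef) ∧
      (∀ s : Set.Icc (0 : ℝ) 1, (s : ℝ) = 1 → g s = 0) ∧
      ∀ z ∈ Complex.slitPlane, ∀ i j, F z i j = A i j +
        ∫ s, z / (1 - ((s : ℝ) : ℂ) + ((s : ℝ) : ℂ) * z) * g s i j ∂μ := by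
  obtain ⟨μ, g, hμ, hgm, hgi, hgp, hg⟩ := exists_representation_Icc hF him hpos
  have hxs : ∀ x : ℝ, 0 < x → (x : ℂ) ∈ Complex.slitPlane := fun x hx =>
    Complex.ofReal_mem_slitPlane.2 hx
  have hM : ∀ i, ∀ x : ℝ, 0 < x → x < 1 →
      (1 - x) * ∫ s : Set.Icc (0 : ℝ) 1, (1 - (s : ℝ) + s * x)⁻¹ * (g s i i).re ∂μ ≤
        (F 1 i i).re := by
    intro i x hx _
    have h0 := (Complex.nonneg_iff.1 ((hpos x hx).diag_nonneg (i := i))).1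
    have hi : Integrable (fun s => affineKernel (hxs x hx) s * g s i i) μ :=
      (affineKernel (hxs x hx)).continuous.integrable_mul_of_compactSpace (hgi i i)
    have e := integral_re hi
    rw [hg x (hxs x hx) i i, Complex.add_re] at h0
    have e2 : (∫ s, affineKernel (hxs x hx) s * g s i i ∂μ).re = -((1 - x) *
        ∫ s : Set.Icc (0 : ℝ) 1, (1 - (s : ℝ) + s * x)⁻¹ * (g s i i).re ∂μ) := by
      rw [← neg_mul, ← integral_const_mul]
      refine e.symm.trans (integral_congr_ae (ae_of_all _ fun s => ?_))
      have : affineKernel (hxs x hx) s = ((-(1 - x) * (1 - (s : ℝ) + s * x)⁻¹ : ℝ) : ℂ) := by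
        simp only [affineKernel, ContinuousMap.coe_mk]
        push_cast
        ring
      simp only [this, RCLike.re_eq_complex_re, Complex.re_ofReal_mul]
      ring
    have e3 : (∫ s, affineKernel (hxs x hx) s * g s i i ∂μ).re = (∫ s : Set.Icc (0 : ℝ) 1,
      ((x : ℂ) - 1) / (1 - ((s : ℝ) : ℂ) + ((s : ℝ) : ℂ) * x) * g s i i ∂μ).re := rfl
    linarith
  obtain ⟨hg1, hgi'⟩ := inv_one_sub_regularity hgi hgp hM
  set g' : Set.Icc (0 : ℝ) 1 → Matrix (Fin d) (Fin d) ℂ :=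
    fun s => (((1 - (s : ℝ))⁻¹ : ℝ) : ℂ) • g s with hg'
  have hg'1 : ∀ s : Set.Icc (0 : ℝ) 1, (s : ℝ) = 1 → g' s = 0 := fun s hs => by
    simp [hg', hs]
  have hg'i : ∀ i j, Integrable (fun s => g' s i j) μ := hgi'
  have hrep : ∀ z ∈ Complex.slitPlane, ∀ i j, F z i j =
      (F 1 i j - ∫ s, g' s i j ∂μ) +
        ∫ s, z / (1 - ((s : ℝ) : ℂ) + ((s : ℝ) : ℂ) * z) * g' s i j ∂μ := by
    intro z hz i j
    have hi1 : Integrable (fun s : Set.Icc (0 : ℝ) 1 =>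
        (z - 1) / (1 - ((s : ℝ) : ℂ) + ((s : ℝ) : ℂ) * z) * g s i j) μ :=
      (affineKernel hz).continuous.integrable_mul_of_compactSpace (hgi i j)
    have key : ∫ s, z / (1 - ((s : ℝ) : ℂ) + ((s : ℝ) : ℂ) * z) * g' s i j ∂μ =
        ∫ s, ((z - 1) / (1 - ((s : ℝ) : ℂ) + ((s : ℝ) : ℂ) * z) * g s i j + g' s i j) ∂μ := by
      refine integral_congr_ae ?_
      filter_upwards [hg1] with s hs
      rcases eq_or_ne (s : ℝ) 1 with h | h
      · simp [hg'1 s h, hs h]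
      · have hD := Complex.affine_ne_zero hz s.2
        have h1 : 1 - ((s : ℝ) : ℂ) ≠ 0 := sub_ne_zero.2 (by exact_mod_cast h.symm)
        simp only [hg', Matrix.smul_apply, smul_eq_mul]
        push_cast
        generalize hDe : 1 - ((s : ℝ) : ℂ) + ((s : ℝ) : ℂ) * z = D at hD ⊢
        field_simp
        rw [← hDe]
        ring
    rw [key, integral_add hi1 (hg'i i j), hg z hz i j]
    ring
  refine ⟨Matrix.of fun i j => F 1 i j - ∫ s, g' s i j ∂μ, μ, g', ?_, hμ, ?_, hg'i, ?_, hg'1, hrep⟩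
  · set x : ℕ → ℝ := fun n => 1 / ((n : ℝ) + 1) with hx
    have hx0 : ∀ n, 0 < x n := fun n => by positivity
    have hx1 : ∀ n, x n ≤ 1 := fun n => by
      simp only [hx]
      exact (div_le_one (by positivity)).2 (by linarith [n.cast_nonneg (α := ℝ)])
    have hxl : Tendsto x atTop (𝓝 0) := tendsto_one_div_add_atTop_nhds_zero_nat
    refine Matrix.posSemidef_of_tendsto (fun n => hpos (x n) (hx0 n)) fun i j => ?_
    have hcast : ∀ n (s : Set.Icc (0 : ℝ) 1),
        (x n : ℂ) / (1 - ((s : ℝ) : ℂ) + ((s : ℝ) : ℂ) * x n) =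
          ((x n / (1 - (s : ℝ) + s * x n) : ℝ) : ℂ) := fun n s => by push_cast; rfl
    have hdom : Tendsto (fun n => ∫ s : Set.Icc (0 : ℝ) 1,
        (x n : ℂ) / (1 - ((s : ℝ) : ℂ) + ((s : ℝ) : ℂ) * x n) * g' s i j ∂μ) atTop
        (𝓝 (∫ _ : Set.Icc (0 : ℝ) 1, (0 : ℂ) ∂μ)) := by
      refine tendsto_integral_of_dominated_convergence (fun s => ‖g' s i j‖) (fun n => ?_)
        (hg'i i j).norm (fun n => ae_of_all _ fun s => ?_) (ae_of_all _ fun s => ?_)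
      · refine AEStronglyMeasurable.mul (Measurable.aestronglyMeasurable (by fun_prop))
          (hg'i i j).aestronglyMeasurable
      · rw [norm_mul, hcast, Complex.norm_real]
        have hp := affine_pos (hx0 n) s
        rw [Real.norm_of_nonneg (div_nonneg (hx0 n).le hp.le)]
        refine mul_le_of_le_one_left (norm_nonneg _) ((div_le_one hp).2 ?_)
        nlinarith [mul_nonneg (sub_nonneg.2 s.2.2) (sub_nonneg.2 (hx1 n))]
      · rcases eq_or_ne (s : ℝ) 1 with h | h
        · simp [hg'1 s h]
        · have h1 : 1 - (s : ℝ) ≠ 0 := sub_ne_zero.2 h.symm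
          have h2 : Tendsto (fun n => x n / (1 - (s : ℝ) + s * x n)) atTop
              (𝓝 (0 / (1 - (s : ℝ) + s * 0))) :=
            hxl.div ((hxl.const_mul _).const_add _) (by simpa using h1)
          have h3 := ((Complex.continuous_ofReal.tendsto _).comp h2).mul_const (g' s i j)
          simp only [zero_div, Complex.ofReal_zero, zero_mul] at h3
          exact h3.congr fun n => by simp only [Function.comp, hcast]
    rw [integral_zero] at hdom
    have := hdom.const_add (F 1 i j - ∫ s, g' s i j ∂μ)
    rw [add_zero] at this
    exact this.congr fun n => (hrep (x n) (hxs _ (hx0 n)) i j).symm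
  · intro i j
    exact (Measurable.mul (by fun_prop) (hgm i j) :
      Measurable fun s : Set.Icc (0 : ℝ) 1 => (((1 - (s : ℝ))⁻¹ : ℝ) : ℂ) * g s i j)
  · filter_upwards [hgp] with s hs
    refine hs.smul ?_
    rw [Complex.zero_le_real]
    exact inv_nonneg.2 (sub_nonneg.2 s.2.2)

/-- Every class S function has a Stieltjes integral representation. -/
theorem exists_representation
    (hF : ∀ i j, DifferentiableOn ℂ (fun z => F z i j) Complex.slitPlane)
    (him : ∀ z ∈ Complex.slitPlane, z.im ≠ 0 → ((z - conj z)⁻¹ • (F z - (F z)ᴴ)).PosSemidef)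
    (hpos : ∀ x : ℝ, 0 < x → (F (x : ℂ)).PosSemidef) :
    ∃ (A C : Matrix (Fin d) (Fin d) ℂ) (ν : Measure ℝ) (g : ℝ → Matrix (Fin d) (Fin d) ℂ),
      A.PosSemidef ∧ C.PosSemidef ∧ IsFiniteMeasure ν ∧ ν (Set.Ioi (0 : ℝ))ᶜ = 0 ∧
      (∀ᵐ t ∂ν, (g t).PosSemidef) ∧ (∀ i j, Integrable (fun t => g t i j) ν) ∧
      (∀ z ∈ Complex.slitPlane, ∀ i j, F z i j = A i j + z * C i j
        + ∫ t : ℝ, (z * (1 + (t : ℂ)) / (z + (t : ℂ))) * g t i j ∂ν) := by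
  obtain ⟨A, μ, g, hA, hμ, hgm, hgi, hgp, hg1, hg⟩ := exists_representation_Icc_inv hF him hpos
  set E : Set (Set.Icc (0 : ℝ) 1) := {s | 0 < (s : ℝ) ∧ (s : ℝ) < 1} with hE
  have hEm : MeasurableSet E :=
    (measurableSet_lt measurable_const measurable_subtype_coe).inter
      (measurableSet_lt measurable_subtype_coe measurable_const)
  set T : Set.Icc (0 : ℝ) 1 → ℝ := fun s => 1 / (s : ℝ) - 1 with hT
  have hTm : Measurable T := by fun_prop
  set S : ℝ → Set.Icc (0 : ℝ) 1 := fun t => Set.projIcc 0 1 zero_le_one (1 / (1 + t)) with hS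
  have hSm : Measurable S := continuous_projIcc.measurable.comp (by fun_prop)
  have hST : ∀ s ∈ E, S (T s) = s := fun s hs => by
    have : 1 / (1 + T s) = s := by
      simp [hT]
    simp only [hS, this, Set.projIcc_val]
  set ν := (μ.restrict E).map T with hν
  have hmap : ν.map S = μ.restrict E := by
    rw [hν, Measure.map_map hSm hTm]
    conv_rhs => rw [← Measure.map_id (μ := μ.restrict E)]
    refine Measure.map_congr ?_
    filter_upwards [ae_restrict_mem hEm] with s hs
    exact hST s hs
  refine ⟨A, Matrix.of fun i j => ∫ s in {⟨0, by simp⟩}, 1 * g s i j ∂μ, ν, fun t => g (S t),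
    hA, ?_, ?_, ?_, ?_, ?_, ?_⟩
  · exact posSemidef_integral_mul
      (fun i j => by simpa only [one_mul, IntegrableOn] using (hgi i j).integrableOn)
      (ae_of_all _ fun _ => zero_le_one) (ae_restrict_of_ae hgp)
  · exact Measure.isFiniteMeasure_map _ _
  · rw [hν, Measure.map_apply hTm measurableSet_Ioi.compl, Measure.restrict_apply
      (hTm measurableSet_Ioi.compl)]
    convert measure_empty (μ := μ)
    ext s
    simp only [Set.mem_inter_iff, Set.mem_preimage, Set.mem_compl_iff, Set.mem_Ioi, hT, hE,
      Set.mem_ofPred_eq, Set.mem_empty_iff_false, iff_false, not_and, not_lt]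
    intro h h0
    by_contra! h1
    have := one_lt_one_div h0 h1
    linarith
  · refine ae_of_ae_map (p := fun s => (g s).PosSemidef) hSm.aemeasurable ?_
    rw [hmap]
    exact ae_restrict_of_ae hgp
  · intro i j
    have : Integrable (fun s => g s i j) (ν.map S) := by
      rw [hmap]
      exact (hgi i j).integrableOn
    exact this.comp_measurable hSm
  · intro z hz i j
    set k : Set.Icc (0 : ℝ) 1 → ℂ := fun s => z / (1 - ((s : ℝ) : ℂ) + ((s : ℝ) : ℂ) * z) with hk
    have hkc : Continuous k :=
      Continuous.div (by fun_prop) (by fun_prop) fun s => Complex.affine_ne_zero hz s.2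
    have hi : Integrable (fun s => k s * g s i j) μ :=
      hkc.integrable_mul_of_compactSpace (hgi i j)
    have hmeas : Measurable fun t : ℝ => (z * (1 + (t : ℂ)) / (z + (t : ℂ))) * g (S t) i j :=
      Measurable.mul (by fun_prop) ((hgm i j).comp hSm)
    have h0m : MeasurableSet ({⟨0, by simp⟩} : Set (Set.Icc (0 : ℝ) 1)) :=
      measurableSet_singleton _
    have e1 : ∫ s in {⟨0, by simp⟩}, k s * g s i j ∂μ =
        z * ∫ s in {⟨0, by simp⟩}, 1 * g s i j ∂μ := by
      rw [← integral_const_mul]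
      refine setIntegral_congr_fun h0m fun s hs => ?_
      have hs : s = ⟨0, by simp⟩ := hs
      simp [hk, hs]
    have e2 : ∫ s in {⟨0, by simp⟩}ᶜ, k s * g s i j ∂μ = ∫ s in E, k s * g s i j ∂μ := by
      refine setIntegral_eq_of_subset_of_forall_sdiff_eq_zero h0m.compl ?_ ?_
      · intro s hs h0
        have h0 : s = ⟨0, by simp⟩ := h0
        have := hs.1
        simp [h0] at this
      · rintro s ⟨hs0, hsE⟩
        have h0 : (s : ℝ) ≠ 0 := fun h => hs0 (Subtype.ext h)
        have : (s : ℝ) = 1 := by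
          by_contra h
          exact hsE ⟨lt_of_le_of_ne s.2.1 h0.symm, lt_of_le_of_ne s.2.2 h⟩
        simp [hg1 s this]
    have e3 : ∫ t : ℝ, (z * (1 + (t : ℂ)) / (z + (t : ℂ))) * g (S t) i j ∂ν =
        ∫ s in E, k s * g s i j ∂μ := by
      rw [hν, integral_map hTm.aemeasurable hmeas.aestronglyMeasurable]
      refine setIntegral_congr_fun hEm fun s hs => ?_
      have h0 : ((s : ℝ) : ℂ) ≠ 0 := by exact_mod_cast hs.1.ne'
      have hD := Complex.affine_ne_zero hz s.2
      simp only [hST s hs]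
      congr 1
      have hzT : z + (T s : ℂ) = (1 - ((s : ℝ) : ℂ) + ((s : ℝ) : ℂ) * z) / (s : ℝ) := by
        simp only [hT]
        push_cast
        field_simp
        ring
      rw [hzT]
      simp only [hT, hk]
      push_cast
      field_simp
      ring
    rw [hg z hz i j, ← integral_add_compl h0m hi, e1, e2, ← e3, ← add_assoc]
    rfl

end Forward

section Reverse

theorem exists_bound_stieltjesKernel {z : ℂ} (hz : z ∈ Complex.slitPlane) :
    ∃ K : ℝ, ∀ t : ℝ, 0 < t → ‖z * (1 + (t : ℂ)) / (z + (t : ℂ))‖ ≤ K := by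
  have hkc : ContinuousOn (fun s : ℝ => z / (1 - (s : ℂ) + s * z)) (Set.Icc 0 1) :=
    ContinuousOn.div (by fun_prop) (by fun_prop) fun s hs => Complex.affine_ne_zero hz hs
  obtain ⟨K, hK⟩ := isCompact_Icc.exists_bound_of_continuousOn hkc
  refine ⟨K, fun t ht => ?_⟩
  have hs : 1 / (1 + t) ∈ Set.Icc (0 : ℝ) 1 :=
    ⟨by positivity, (div_le_one (by positivity)).2 (by linarith)⟩
  have h1 : (1 + t : ℂ) ≠ 0 := by
    have : (1 + t : ℝ) ≠ 0 := by positivity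
    exact_mod_cast this
  have h2 : 1 - ((1 / (1 + t) : ℝ) : ℂ) + (1 / (1 + t) : ℝ) * z = (z + t) / (1 + t) := by
    push_cast
    field_simp
    ring
  have h := hK _ hs
  rwa [h2, div_div_eq_mul_div] at h

variable {d : ℕ} {F : ℂ → Matrix (Fin d) (Fin d) ℂ} {A C : Matrix (Fin d) (Fin d) ℂ}
  {ν : Measure ℝ} {g : ℝ → Matrix (Fin d) (Fin d) ℂ}

theorem integrable_stieltjesKernel_mul (hν : ∀ᵐ t ∂ν, 0 < t) {h : ℝ → ℂ} (hh : Integrable h ν)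
    {z : ℂ} (hz : z ∈ Complex.slitPlane) :
    Integrable (fun t : ℝ => z * (1 + (t : ℂ)) / (z + (t : ℂ)) * h t) ν := by
  obtain ⟨K, hK⟩ := exists_bound_stieltjesKernel hz
  refine hh.bdd_mul (c := K) (Measurable.aestronglyMeasurable (by fun_prop)) ?_
  filter_upwards [hν] with t ht using hK t ht

theorem posSemidef_of_representation_of_pos (hA : A.PosSemidef) (hC : C.PosSemidef)
    (hν : ∀ᵐ t ∂ν, 0 < t) (hgp : ∀ᵐ t ∂ν, (g t).PosSemidef)
    (hgi : ∀ i j, Integrable (fun t => g t i j) ν)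
    (hrep : ∀ z ∈ Complex.slitPlane, ∀ i j, F z i j = A i j + z * C i j
      + ∫ t : ℝ, (z * (1 + (t : ℂ)) / (z + (t : ℂ))) * g t i j ∂ν) {x : ℝ} (hx : 0 < x) :
    (F (x : ℂ)).PosSemidef := by
  have hxs : (x : ℂ) ∈ Complex.slitPlane := Complex.ofReal_mem_slitPlane.2 hx
  have h := posSemidef_integral_mul
    (fun i j => integrable_stieltjesKernel_mul hν (hgi i j) hxs) (by
      filter_upwards [hν] with t ht
      have : (0 : ℝ) ≤ x * (1 + t) / (x + t) := by positivity
      exact_mod_cast this) hgp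
  have hx0 : (0 : ℂ) ≤ x := Complex.zero_le_real.2 hx.le
  convert (hA.add (hC.smul hx0)).add h using 1
  ext i j
  simp [hrep x hxs i j]

theorem posSemidef_of_representation_of_im_ne_zero (hA : A.PosSemidef) (hC : C.PosSemidef)
    (hν : ∀ᵐ t ∂ν, 0 < t) (hgp : ∀ᵐ t ∂ν, (g t).PosSemidef)
    (hgi : ∀ i j, Integrable (fun t => g t i j) ν)
    (hrep : ∀ z ∈ Complex.slitPlane, ∀ i j, F z i j = A i j + z * C i j
      + ∫ t : ℝ, (z * (1 + (t : ℂ)) / (z + (t : ℂ))) * g t i j ∂ν)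
    {z : ℂ} (hz : z ∈ Complex.slitPlane) (hzi : z.im ≠ 0) :
    ((z - conj z)⁻¹ • (F z - (F z)ᴴ)).PosSemidef := by
  have hne : z - conj z ≠ 0 := by
    rw [Complex.sub_conj]
    simpa using hzi
  have hzc : conj z ∈ Complex.slitPlane := by simpa [Complex.mem_slitPlane_iff] using hz
  set k : ℂ → ℝ → ℂ := fun z t => z * (1 + (t : ℂ)) / (z + (t : ℂ)) with hk
  have hkc : ∀ t, conj (k z t) = k (conj z) t := fun t => by simp [hk]
  have hi : ∀ i j, Integrable (fun t => k z t * g t i j) ν := fun i j =>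
    integrable_stieltjesKernel_mul hν (hgi i j) hz
  have hic : ∀ i j, Integrable (fun t => k (conj z) t * g t i j) ν := fun i j =>
    integrable_stieltjesKernel_mul hν (hgi i j) hzc
  have h := posSemidef_integral_mul (κ := fun t => (z - conj z)⁻¹ * (k z t - k (conj z) t))
    (W := g) (μ := ν)
    (fun i j => by
      refine (((hi i j).sub (hic i j)).const_mul (z - conj z)⁻¹).congr (ae_of_all _ fun t => ?_)
      simp only [Pi.sub_apply]
      ring) (by
      filter_upwards [hν] with t ht
      have h1 : z + t ≠ 0 := fun h => hzi (by simpa using congrArg Complex.im h)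
      have h2 : conj z + t ≠ 0 := fun h => hzi (by simpa using congrArg Complex.im h)
      have e : (z - conj z)⁻¹ * (k z t - k (conj z) t) =
          (t * (1 + t) / Complex.normSq (z + t) : ℝ) := by
        push_cast
        rw [← Complex.mul_conj]
        simp only [hk, map_add, Complex.conj_ofReal]
        field_simp
        ring
      rw [e, Complex.zero_le_real]
      have := Complex.normSq_nonneg (z + t)
      positivity) hgp
  convert hC.add h using 1
  ext i j
  have e : conj (∫ t, k z t * g t j i ∂ν) = ∫ t, k (conj z) t * g t i j ∂ν := by
    rw [← integral_conj]
    refine integral_congr_ae ?_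
    filter_upwards [hgp] with t ht
    rw [map_mul, hkc, ← ht.isHermitian.apply i j]
    rfl
  have eA : conj (A j i) = A i j := hA.isHermitian.apply i j
  have eC : conj (C j i) = C i j := hC.isHermitian.apply i j
  have e2 : ∫ t, (z - conj z)⁻¹ * (k z t - k (conj z) t) * g t i j ∂ν =
      (z - conj z)⁻¹ * (∫ t, k z t * g t i j ∂ν - ∫ t, k (conj z) t * g t i j ∂ν) := by
    rw [← integral_sub (hi i j) (hic i j), ← integral_const_mul]
    exact integral_congr_ae (ae_of_all _ fun t => by ring)
  have hF : ∀ i j, F z i j = A i j + z * C i j + ∫ t, k z t * g t i j ∂ν := hrep z hz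
  simp only [Matrix.smul_apply, Matrix.sub_apply, Matrix.conjTranspose_apply, smul_eq_mul,
    Matrix.add_apply, Matrix.of_apply, e2]
  rw [← starRingEnd_apply, hF i j, hF j i, map_add, map_add, map_mul, eA, eC, e]
  field_simp
  ring

end Reverse

end

/-- A holomorphic `d × d`-matrix-valued function `F` on `ℂ ∖ (-∞, 0]`
belongs to the Stieltjes class `S` (i.e. `(F(z) - F(z)ᴴ)/(z - conj z)` is positive
semidefinite for `Im z ≠ 0` and `F(x)` is positive semidefinite for real `x > 0`)
if and only if it admits the integral representation
`F(z) = A + C z + ∫ z/(z+t) dσ(t)` with `A, C ⪰ 0` and a positive-matrix-valued Borel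
measure `σ` on `(0, ∞)` with `∫ (1+t)⁻¹ dσ(t)` finite.  The measure `σ` is encoded by
a finite positive measure `ν` on `(0, ∞)` together with an a.e. positive semidefinite
matrix density `g` (so `dσ(t) = (1+t) g(t) dν(t)`), whence
`∫ z/(z+t) dσ(t) = ∫ z(1+t)/(z+t) g(t) dν(t)` entrywise. -/
theorem stmt_0 (d : ℕ) (hd : 1 ≤ d) (F : ℂ → Matrix (Fin d) (Fin d) ℂ)
    (hF : ∀ i j, DifferentiableOn ℂ (fun z => F z i j) Complex.slitPlane) :
    ((∀ z ∈ Complex.slitPlane, z.im ≠ 0 →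
        ((z - conj z)⁻¹ • (F z - (F z)ᴴ)).PosSemidef) ∧
      (∀ x : ℝ, 0 < x → (F (x : ℂ)).PosSemidef))
    ↔ ∃ (A C : Matrix (Fin d) (Fin d) ℂ) (ν : Measure ℝ)
        (g : ℝ → Matrix (Fin d) (Fin d) ℂ),
        A.PosSemidef ∧ C.PosSemidef ∧ IsFiniteMeasure ν ∧
        ν (Set.Ioi (0:ℝ))ᶜ = 0 ∧
        (∀ᵐ t ∂ν, (g t).PosSemidef) ∧
        (∀ i j, Integrable (fun t => g t i j) ν) ∧
        (∀ z ∈ Complex.slitPlane, ∀ i j,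
          F z i j = A i j + z * C i j
            + ∫ t : ℝ, (z * (1 + (t : ℂ)) / (z + (t : ℂ))) * g t i j ∂ν) := by
  constructor
  · rintro ⟨him, hpos⟩
    exact exists_representation hF him hpos
  · rintro ⟨A, C, ν, g, hA, hC, -, hν, hgp, hgi, hrep⟩
    have hν' : ∀ᵐ t ∂ν, 0 < t := hν
    exact ⟨fun z hz hzi => posSemidef_of_representation_of_im_ne_zero hA hC hν' hgp hgi hrep hz hzi,
      fun x hx => posSemidef_of_representation_of_pos hA hC hν' hgp hgi hrep hx⟩
end

section
/- Let x₋ < x₊ be real numbers and let v be a function holomorphic on ℂ⁺ ∪ ℂ⁻ ∪ (x₋, x₊) such that Im v(z) ≥ 0 for all z in the open upper half-plane ℂ⁺, v is real-valued on the interval (x₋, x₊), and the limit lim_{y→+∞} v(iy)/(iy) = f_∞ exists with f_∞ > 0. Then for every x₀ ∈ (x₋, x₊) the derivative satisfies v′(x₀) ≥ f_∞. Consequently v(x₁) − v(x₂) ≥ f_∞ · (x₁ − x₂) for all x₂ < x₁ in (x₋, x₊). -/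
open scoped ComplexOrder


open Complex ComplexConjugate Filter Topology

/-- The square of the distance to the reflected point. -/
theorem normSq_sub_eq_normSq_sub_conj (a b : ℂ) :
    normSq (a - b) = normSq (a - conj b) - 4 * a.im * b.im := by
  simp only [normSq_apply, sub_re, sub_im, conj_re, conj_im]
  ring

theorem sub_conj_ne_zero_of_im {a b : ℂ} (ha : 0 ≤ a.im) (hb : 0 < b.im) : a - conj b ≠ 0 := by
  intro h
  have h' := congrArg im h
  simp only [sub_im, conj_im, zero_im] at h'
  linarith

/-- The **Schwarz-Pick inequality** for holomorphic functions from the open upper half-plane to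
the closed upper half-plane. -/
theorem schwarz_pick_upperHalfPlane {f : ℂ → ℂ} (hf : DifferentiableOn ℂ f {z | 0 < z.im})
    (him : ∀ z : ℂ, 0 < z.im → 0 ≤ (f z).im) {z w : ℂ} (hz : 0 < z.im) (hw : 0 < w.im)
    (hfw : 0 < (f w).im) :
    z.im * w.im * normSq (f z - conj (f w)) ≤ (f z).im * (f w).im * normSq (z - conj w) := by
  set φ : ℂ → ℂ := fun ζ => (w - conj w * ζ) / (1 - ζ) with hφ
  set h : ℂ → ℂ := fun ζ => (f (φ ζ) - f w) / (f (φ ζ) - conj (f w)) with hh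
  have hne : ∀ ζ ∈ Metric.ball (0 : ℂ) 1, 1 - ζ ≠ 0 := by
    intro ζ hζ h0
    rw [mem_ball_zero_iff, ← sub_eq_zero.mp h0] at hζ
    simp at hζ
  have hφim : ∀ ζ ∈ Metric.ball (0 : ℂ) 1, 0 < (φ ζ).im := by
    intro ζ hζ
    have h1 : 0 < normSq (1 - ζ) := normSq_pos.mpr (hne ζ hζ)
    have h2 : normSq ζ < 1 := by
      rw [mem_ball_zero_iff] at hζ
      rw [normSq_eq_norm_sq]
      nlinarith [norm_nonneg ζ]
    have h3 : (φ ζ).im = w.im * (1 - normSq ζ) / normSq (1 - ζ) := by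
      simp only [hφ, div_im]
      rw [← sub_div]
      congr 1
      simp only [normSq_apply, sub_re, sub_im, mul_re, mul_im, conj_re, conj_im, one_re, one_im]
      ring
    rw [h3]
    exact div_pos (mul_pos hw (by linarith)) h1
  have hden : ∀ ζ ∈ Metric.ball (0 : ℂ) 1, f (φ ζ) - conj (f w) ≠ 0 := fun ζ hζ =>
    sub_conj_ne_zero_of_im (him _ (hφim ζ hζ)) hfw
  have hφd : DifferentiableOn ℂ φ (Metric.ball 0 1) :=
    DifferentiableOn.div (by fun_prop) (by fun_prop) hne
  have hfφ : DifferentiableOn ℂ (fun ζ => f (φ ζ)) (Metric.ball 0 1) := hf.comp hφd hφim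
  have hhd : DifferentiableOn ℂ h (Metric.ball 0 1) :=
    (hfφ.sub_const _).div (hfφ.sub_const _) hden
  have hmaps : Set.MapsTo h (Metric.ball 0 1) (Metric.closedBall 0 1) := by
    intro ζ hζ
    rw [mem_closedBall_zero_iff, norm_div, div_le_one (norm_pos_iff.mpr (hden ζ hζ))]
    refine (sq_le_sq₀ (norm_nonneg _) (norm_nonneg _)).mp ?_
    rw [← normSq_eq_norm_sq, ← normSq_eq_norm_sq, normSq_sub_eq_normSq_sub_conj]
    have := mul_nonneg (him _ (hφim ζ hζ)) hfw.le
    linarith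
  have h0 : h 0 = 0 := by simp [hh, hφ]
  have hzw := sub_conj_ne_zero_of_im hz.le hw
  have hζn : ‖(z - w) / (z - conj w)‖ < 1 := by
    rw [norm_div, div_lt_one (norm_pos_iff.mpr hzw)]
    refine lt_of_pow_lt_pow_left₀ 2 (norm_nonneg _) ?_
    rw [← normSq_eq_norm_sq, ← normSq_eq_norm_sq, normSq_sub_eq_normSq_sub_conj]
    have := mul_pos hz hw
    linarith
  have hφz : φ ((z - w) / (z - conj w)) = z := by
    have := hne _ (mem_ball_zero_iff.mpr hζn)
    rw [hφ]
    simp only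
    rw [div_eq_iff this]
    field_simp
    ring
  have key := norm_le_norm_of_mapsTo_ball hhd hmaps h0 hζn
  simp only [hh, hφz, norm_div] at key
  have hP := sub_conj_ne_zero_of_im (him z hz) hfw
  rw [div_le_div_iff₀ (norm_pos_iff.mpr hP) (norm_pos_iff.mpr hzw)] at key
  have key2 := pow_le_pow_left₀ (by positivity) key 2
  rw [mul_pow, mul_pow] at key2
  simp only [← normSq_eq_norm_sq] at key2
  rw [normSq_sub_eq_normSq_sub_conj (f z), normSq_sub_eq_normSq_sub_conj z w] at key2
  linarith

/-- A Herglotz-Nevanlinna function with linear growth coefficient `c > 0` at infinity satisfies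
`Im f(z) ≥ c Im z`. -/
theorem mul_im_le_im_of_tendsto_div {f : ℂ → ℂ} (hf : DifferentiableOn ℂ f {z | 0 < z.im})
    (him : ∀ z : ℂ, 0 < z.im → 0 ≤ (f z).im) {c : ℝ} (hc : 0 < c)
    (hlim : Tendsto (fun y : ℝ => f (y * I) / (y * I)) atTop (𝓝 (c : ℂ)))
    {z : ℂ} (hz : 0 < z.im) : c * z.im ≤ (f z).im := by
  have hinv : Tendsto (fun y : ℝ => ((y⁻¹ : ℝ) : ℂ)) atTop (𝓝 0) := by
    simpa [Function.comp_def] using (continuous_ofReal.tendsto 0).comp tendsto_inv_atTop_zero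
  have hfI : Tendsto (fun y : ℝ => f (y * I) * ((y⁻¹ : ℝ) : ℂ)) atTop (𝓝 (c * I)) := by
    refine (hlim.mul_const I).congr' ?_
    filter_upwards [eventually_gt_atTop 0] with y hy
    have : (y : ℂ) ≠ 0 := ofReal_ne_zero.mpr hy.ne'
    push_cast
    field_simp
  have hfim : Tendsto (fun y : ℝ => (f (y * I)).im * y⁻¹) atTop (𝓝 c) := by
    have h1 := (continuous_im.tendsto _).comp hfI
    rw [im_ofReal_mul, I_im, mul_one] at h1
    exact h1.congr fun y => im_mul_ofReal _ _
  have hleft : Tendsto (fun y : ℝ => normSq (f z - conj (f (y * I))) * y⁻¹ ^ 2) atTop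
      (𝓝 (c ^ 2)) := by
    have h1 : Tendsto (fun y : ℝ => f z * ((y⁻¹ : ℝ) : ℂ) -
        conj (f (y * I) * ((y⁻¹ : ℝ) : ℂ))) atTop (𝓝 (f z * 0 - conj (c * I))) :=
      (hinv.const_mul _).sub ((continuous_conj.tendsto _).comp hfI)
    have h2 := (continuous_normSq.tendsto _).comp h1
    have h3 : normSq (f z * 0 - conj ((c : ℂ) * I)) = c ^ 2 := by
      simp [normSq_apply]; ring
    rw [h3] at h2
    refine h2.congr fun y => ?_
    rw [Function.comp_apply, map_mul, conj_ofReal, ← sub_mul, normSq_mul, normSq_ofReal, sq]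
  have hright : Tendsto (fun y : ℝ => normSq (z - conj ((y : ℂ) * I)) * y⁻¹ ^ 2) atTop
      (𝓝 1) := by
    have h1 : Tendsto (fun y : ℝ => z * ((y⁻¹ : ℝ) : ℂ) + I) atTop (𝓝 (z * 0 + I)) :=
      (hinv.const_mul _).add_const I
    have h2 := (continuous_normSq.tendsto _).comp h1
    have h3 : normSq (z * 0 + I) = 1 := by simp
    rw [h3] at h2
    refine h2.congr' ?_
    filter_upwards [eventually_gt_atTop 0] with y hy
    have hy' : (y : ℂ) ≠ 0 := ofReal_ne_zero.mpr hy.ne'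
    have h4 : z * ((y⁻¹ : ℝ) : ℂ) + I = (z - conj ((y : ℂ) * I)) * ((y⁻¹ : ℝ) : ℂ) := by
      simp only [map_mul, conj_ofReal, conj_I]
      push_cast
      field_simp
      ring
    rw [Function.comp_apply, h4, normSq_mul, normSq_ofReal, sq]
  have hmain : z.im * c ^ 2 ≤ (f z).im * c * 1 := by
    refine le_of_tendsto_of_tendsto (hleft.const_mul z.im) ((hfim.const_mul _).mul hright) ?_
    filter_upwards [eventually_gt_atTop 0, hfim.eventually_const_lt hc] with y hy hpos
    have hfy : 0 < (f (y * I)).im := pos_of_mul_pos_left hpos (inv_nonneg.mpr hy.le)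
    have hsp := schwarz_pick_upperHalfPlane hf him hz (w := (y : ℂ) * I) (by simpa using hy) hfy
    have hyI : ((y : ℂ) * I).im = y := by simp
    rw [hyI] at hsp
    have := mul_le_mul_of_nonneg_right hsp (by positivity : (0 : ℝ) ≤ y⁻¹ ^ 3)
    calc _ = z.im * y * normSq (f z - conj (f (y * I))) * y⁻¹ ^ 3 := by field_simp
      _ ≤ _ := this
      _ = _ := by ring
  nlinarith

/-- Let `v` be holomorphic on `ℂ⁺ ∪ ℂ⁻ ∪ (x₋, x₊)` with `Im v ≥ 0`
on the open upper half-plane, real-valued on `(x₋, x₊)`, and with linear growth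
coefficient `lim_{y→∞} v(iy)/(iy) = f_∞ > 0` at infinity.  Then `v′(x₀) ≥ f_∞` for
every `x₀ ∈ (x₋, x₊)`, and consequently `v(x₁) - v(x₂) ≥ f_∞ (x₁ - x₂)` for
`x₂ < x₁` in `(x₋, x₊)`.  (The inequalities between complex numbers are with
respect to the complex partial order, i.e. the quantities are real and ordered.) -/
theorem stmt_5 (xm xp : ℝ) (hx : xm < xp) (v : ℂ → ℂ) (finf : ℝ)
    (hv : DifferentiableOn ℂ v {z : ℂ | z.im ≠ 0 ∨ (xm < z.re ∧ z.re < xp)})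
    (him : ∀ z : ℂ, 0 < z.im → 0 ≤ (v z).im)
    (hreal : ∀ x : ℝ, xm < x → x < xp → (v (x : ℂ)).im = 0)
    (hfinf : 0 < finf)
    (hlim : Filter.Tendsto (fun y : ℝ => v ((y : ℂ) * Complex.I) / ((y : ℂ) * Complex.I))
      Filter.atTop (nhds (finf : ℂ))) :
    (∀ x₀ : ℝ, xm < x₀ → x₀ < xp → (finf : ℂ) ≤ deriv v (x₀ : ℂ)) ∧
    (∀ x₂ x₁ : ℝ, xm < x₂ → x₂ < x₁ → x₁ < xp →
      ((finf * (x₁ - x₂) : ℝ) : ℂ) ≤ v (x₁ : ℂ) - v (x₂ : ℂ)) := by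
  have hopen : IsOpen {z : ℂ | z.im ≠ 0 ∨ (xm < z.re ∧ z.re < xp)} :=
    (isOpen_ne_fun continuous_im continuous_const).union
      ((isOpen_lt continuous_const continuous_re).inter (isOpen_lt continuous_re continuous_const))
  have hd : ∀ x : ℝ, xm < x → x < xp → HasDerivAt v (deriv v x) x := fun x h1 h2 =>
    (hv.differentiableAt (hopen.mem_nhds (Or.inr ⟨by simpa using h1, by simpa using h2⟩))).hasDerivAt
  have hgrowth : ∀ z : ℂ, 0 < z.im → finf * z.im ≤ (v z).im := fun z hz =>
    mul_im_le_im_of_tendsto_div (hv.mono fun z hz => Or.inl (ne_of_gt hz)) him hfinf hlim hz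
  have hre : ∀ x : ℝ, xm < x → x < xp → finf ≤ (deriv v x).re := by
    intro x h1 h2
    have hline : HasDerivAt (fun t : ℂ => (x : ℂ) + t * I) I 0 := by
      simpa using ((hasDerivAt_id (0 : ℂ)).mul_const I).const_add (x : ℂ)
    have hcomp : HasDerivAt (fun t : ℂ => -I * v (x + t * I)) (-I * (deriv v x * I))
        ((0 : ℝ) : ℂ) := by
      refine HasDerivAt.const_mul _ (HasDerivAt.comp (h₂ := v) _ ?_ (by simpa using hline))
      simpa using hd x h1 h2
    have hslope := hcomp.real_of_complex.tendsto_slope_zero_right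
    have hval : (-I * (deriv v x * I)).re = (deriv v x).re := by simp
    rw [hval] at hslope
    refine ge_of_tendsto hslope ?_
    filter_upwards [self_mem_nhdsWithin] with t ht
    have ht : 0 < t := ht
    have hg := hgrowth (x + t * I) (by simpa using ht)
    have him0 := hreal x h1 h2
    have hre_im : ∀ a : ℂ, (-I * a).re = a.im := fun a => by simp
    rw [ofReal_zero, zero_mul, add_zero, zero_add, hre_im, hre_im, him0, sub_zero, smul_eq_mul,
      le_inv_mul_iff₀ ht]
    simpa [mul_comm] using hg
  have him' : ∀ x : ℝ, xm < x → x < xp → (deriv v x).im = 0 := by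
    intro x h1 h2
    have h := ((hd x h1 h2).const_mul (-I)).real_of_complex
    have hz : (fun y : ℝ => (-I * v y).re) =ᶠ[𝓝 x] fun _ => 0 := by
      filter_upwards [Ioo_mem_nhds h1 h2] with y hy
      simpa using hreal y hy.1 hy.2
    have := h.unique ((hasDerivAt_const x (0 : ℝ)).congr_of_eventuallyEq hz)
    simpa using this
  refine ⟨fun x h1 h2 => Complex.le_def.mpr
    ⟨by simpa using hre x h1 h2, by simpa using (him' x h1 h2).symm⟩, fun x₂ x₁ h2 h21 h1 => ?_⟩
  have hdr : ∀ x ∈ Set.Ioo xm xp, HasDerivAt (fun x : ℝ => (v x).re) (deriv v x).re x :=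
    fun x hx => (hd x hx.1 hx.2).real_of_complex
  have hmv := (convex_Ioo xm xp).mul_sub_le_image_sub_of_le_deriv (C := finf)
    (fun x hx => (hdr x hx).continuousAt.continuousWithinAt)
    (fun x hx => (hdr x (interior_subset hx)).differentiableAt.differentiableWithinAt)
    (fun x hx => by
      have hx := interior_subset hx
      rw [(hdr x hx).deriv]
      exact hre x hx.1 hx.2)
    x₂ ⟨h2, h21.trans h1⟩ x₁ ⟨h2.trans h21, h1⟩ h21.le
  refine Complex.le_def.mpr ⟨by rw [ofReal_re, sub_re]; exact hmv, ?_⟩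
  rw [ofReal_im, sub_im, hreal x₁ (h2.trans h21) h1, hreal x₂ h2 (h21.trans h1), sub_zero]
end
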